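/- Assume H is finite, F is algebraically closed, and char F does not divide |H|. Let W be a G-graded simple left R-module and 𝓕 a maximal graded subfield of C(W) isomorphic to FH as a G-graded algebra. Let D = C(W), let T be the support of D, let 𝓩 = Z(D) be the center of D with support Z (so Z ⊆ H and 𝓩 ≅ FZ), and let ε_1, …, ε_m be the primitive idempotents of 𝓩, so that D = Dε_1 ⊕ ⋯ ⊕ Dε_m with each Dε_i a simple ideal isomorphic to a matrix algebra M_{n_i}(F). Then: each Dε_i is a central G/Z-graded division algebra with support T/Z, where the G/Z-grading is given by (Dε_i)_{tZ} = D_t·ε_i for t ∈ T; n_1 = ⋯ = n_m = |H/Z| = √|T/Z|; and for all 1 ≤ i, j ≤ m, Dε_i and Dε_j are isomorphic as G/Z-graded algebras. -/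

import Mathlib

/-! Common definitions: gradings on algebras and modules, graded simplicity,
homogeneous endomorphisms, graded subfields, and loop modules. -/

noncomputable section

namespace GradedPaper

variable {F : Type*} [Field F]

/-- `ℳ` is a direct sum decomposition of the `F`-vector space `V`:
every vector is a finite sum of homogeneous components, and such
decompositions are unique (independence). -/
def IsVSDecomp {V ι : Type*} [AddCommGroup V] [Module F V]
    (ℳ : ι → Submodule F V) : Prop :=
  (∀ v : V, ∃ (t : Finset ι) (c : ι → V), (∀ i ∈ t, c i ∈ ℳ i) ∧ v = ∑ i ∈ t, c i) ∧
  (∀ (t : Finset ι) (c : ι → V), (∀ i ∈ t, c i ∈ ℳ i) → ∑ i ∈ t, c i = 0 →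
    ∀ i ∈ t, c i = 0)

/-- A `G`-grading on a unital associative `F`-algebra `R`:
`R = ⊕_{g ∈ G} R_g` with `1 ∈ R_0` and `R_g · R_h ⊆ R_{g+h}`.
(The abelian grading group is written additively.) -/
structure AlgebraGrading (F : Type*) [Field F] (G : Type*) [AddCommGroup G]
    (R : Type*) [Ring R] [Algebra F R] where
  comp : G → Submodule F R
  decomp : IsVSDecomp comp
  one_mem : (1 : R) ∈ comp 0
  mul_mem : ∀ {g h : G} {r s : R}, r ∈ comp g → s ∈ comp h → r * s ∈ comp (g + h)

variable {G : Type*} [AddCommGroup G] {R : Type*} [Ring R] [Algebra F R]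

/-- A grading of a left `R`-module `V` by the group `κ`, compatible with the
`G`-grading `𝒜` of `R` along the homomorphism `p : G →+ κ`
(so `R_g · V_k ⊆ V_{p g + k}`).  For `p = id` this is a `G`-graded module;
for `p : G →+ G ⧸ H` the natural projection, this is a `G/H`-graded module
(for the induced `G/H`-grading of `R`). -/
structure ModuleGrading (𝒜 : AlgebraGrading F G R) {κ : Type*} [AddCommGroup κ]
    (p : G →+ κ) (V : Type*) [AddCommGroup V] [Module F V] [Module R V]
    [IsScalarTower F R V] where
  comp : κ → Submodule F V
  decomp : IsVSDecomp comp
  smul_mem : ∀ {g : G} {k : κ} {r : R} {v : V},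
    r ∈ 𝒜.comp g → v ∈ comp k → r • v ∈ comp (p g + k)

/-- `W` is a graded submodule: every element of `W` is a finite sum of
homogeneous elements of `W`. -/
def IsGradedSubmodule {κ V : Type*} [AddCommGroup V] [Module F V] [Module R V]
    (ℳ : κ → Submodule F V) (W : Submodule R V) : Prop :=
  ∀ w ∈ W, ∃ (t : Finset κ) (c : κ → V),
    (∀ i ∈ t, c i ∈ ℳ i ∧ c i ∈ W) ∧ w = ∑ i ∈ t, c i

/-- The graded module with components `ℳ` is graded simple. -/
def IsGradedSimpleModule (R : Type*) [Ring R] {κ V : Type*} [AddCommGroup V]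
    [Module F V] [Module R V] (ℳ : κ → Submodule F V) : Prop :=
  (∃ v : V, v ≠ 0) ∧ ∀ W : Submodule R V, IsGradedSubmodule ℳ W → W = ⊥ ∨ W = ⊤

/-- An `R`-module endomorphism of `V` is homogeneous of degree `d`. -/
def IsHomogeneousEnd {κ V : Type*} [Add κ] [AddCommGroup V] [Module F V]
    [Module R V] (ℳ : κ → Submodule F V) (d : κ) (f : Module.End R V) : Prop :=
  ∀ ⦃k : κ⦄ ⦃v : V⦄, v ∈ ℳ k → f v ∈ ℳ (k + d)

/-- The degree-`d` homogeneous component of the (graded) centralizer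
`C(V) = End_R(V)`. -/
def homogComp {κ V : Type*} [Add κ] [AddCommGroup V] [Module F V] [Module R V]
    [SMulCommClass R F V] (ℳ : κ → Submodule F V) (d : κ) :
    Submodule F (Module.End R V) where
  carrier := {f | IsHomogeneousEnd ℳ d f}
  add_mem' := fun hf hg k v hv => (ℳ _).add_mem (hf hv) (hg hv)
  zero_mem' := fun k v hv => (ℳ _).zero_mem
  smul_mem' := fun c f hf k v hv => by
    simpa using (ℳ _).smul_mem c (hf hv)

/-- `f` belongs to the graded centralizer: it is a finite sum of homogeneous
`R`-module endomorphisms. -/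
def IsInGradedCentralizer {κ V : Type*} [Add κ] [AddCommGroup V] [Module F V]
    [Module R V] (ℳ : κ → Submodule F V) (f : Module.End R V) : Prop :=
  ∃ (t : Finset κ) (c : κ → Module.End R V),
    (∀ d ∈ t, IsHomogeneousEnd ℳ d (c d)) ∧ f = ∑ d ∈ t, c d

/-- The module `V` is central (Schurian): its centralizer consists of the
scalar multiples of the identity. -/
def IsCentralModule (F : Type*) [Field F] (R V : Type*) [Ring R] [AddCommGroup V]
    [Module F V] [Module R V] : Prop :=
  ∀ f : Module.End R V, ∃ a : F, ∀ v : V, f v = a • v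

/-- A graded subfield of a graded algebra with homogeneous components `𝒟`:
a graded unital subalgebra (given by its homogeneous components `comp`)
which is commutative and in which every nonzero homogeneous element is
invertible. -/
structure GradedSubfield {κ : Type*} [AddCommGroup κ] {A : Type*} [Ring A]
    [Module F A] (𝒟 : κ → Submodule F A) where
  comp : κ → Submodule F A
  le : ∀ k, comp k ≤ 𝒟 k
  one_mem : (1 : A) ∈ comp 0
  mul_mem : ∀ {g h : κ} {a b : A}, a ∈ comp g → b ∈ comp h → a * b ∈ comp (g + h)
  comm : ∀ {g h : κ} {a b : A}, a ∈ comp g → b ∈ comp h → a * b = b * a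
  inv_mem : ∀ {g : κ} {a : A}, a ∈ comp g → a ≠ 0 →
    ∃ b ∈ comp (-g), a * b = 1 ∧ b * a = 1

/-- The support of a graded subfield. -/
def GradedSubfield.support {κ : Type*} [AddCommGroup κ] {A : Type*} [Ring A]
    [Module F A] {𝒟 : κ → Submodule F A} (𝒦 : GradedSubfield 𝒟) : Set κ :=
  {k | 𝒦.comp k ≠ ⊥}

/-- A graded subfield is maximal if the only graded subfield containing it
is itself. -/
def GradedSubfield.IsMaximal {κ : Type*} [AddCommGroup κ] {A : Type*} [Ring A]
    [Module F A] {𝒟 : κ → Submodule F A} (𝒦 : GradedSubfield 𝒟) : Prop :=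
  ∀ 𝒦' : GradedSubfield 𝒟, (∀ k, 𝒦.comp k ≤ 𝒦'.comp k) → ∀ k, 𝒦'.comp k = 𝒦.comp k

/-- A graded subfield is isomorphic, as a graded algebra, to the group algebra
of its support: it has a homogeneous basis `c` (one-dimensional components)
which is multiplicative. -/
def GradedSubfield.IsGroupAlgebraOfSupport {κ : Type*} [AddCommGroup κ]
    {A : Type*} [Ring A] [Module F A] {𝒟 : κ → Submodule F A}
    (𝒦 : GradedSubfield 𝒟) : Prop :=
  ∃ c : κ → A, c 0 = 1 ∧
    (∀ k ∈ 𝒦.support, c k ∈ 𝒦.comp k ∧ c k ≠ 0 ∧ 𝒦.comp k = Submodule.span F {c k}) ∧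
    (∀ k₁ ∈ 𝒦.support, ∀ k₂ ∈ 𝒦.support, c (k₁ + k₂) = c k₁ * c k₂)

section Loop

variable {Q₁ Q₂ : Type*}

/-- The underlying space of the loop module: inside `V ⊗ F[Q₁] ≅ (Q₁ →₀ V)`,
the subspace `⊕_{a ∈ Q₁} V_{s a} ⊗ a` of finitely supported functions `f` with
`f a ∈ V_{s a}`. -/
def LoopSubmodule {V : Type*} [AddCommGroup V] [Module F V] (s : Q₁ → Q₂)
    (ℳ : Q₂ → Submodule F V) : Submodule F (Q₁ →₀ V) where
  carrier := {f | ∀ a : Q₁, f a ∈ ℳ (s a)}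
  add_mem' := fun hf hg a => by simpa using (ℳ _).add_mem (hf a) (hg a)
  zero_mem' := fun a => by simpa using (ℳ _).zero_mem
  smul_mem' := fun c f hf a => by simpa using (ℳ _).smul_mem c (hf a)

/-- The degree-`a` homogeneous component of the loop module. -/
def loopComp {V : Type*} [AddCommGroup V] [Module F V] (s : Q₁ → Q₂)
    (ℳ : Q₂ → Submodule F V) (a : Q₁) : Submodule F ↥(LoopSubmodule s ℳ) where
  carrier := {x | ∀ b : Q₁, b ≠ a → (x : Q₁ →₀ V) b = 0}
  add_mem' := by
    intro x y hx hy b hb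
    simp [hx b hb, hy b hb]
  zero_mem' := by intro b hb; simp
  smul_mem' := by
    intro c x hx b hb
    simp [hx b hb]

/-- The scalar multiplication of a (possibly non-canonical) module structure,
written explicitly. -/
def msmul {S M : Type*} [Semiring S] [AddCommMonoid M] (i : Module S M)
    (r : S) (x : M) : M :=
  @SMul.smul S M i.toDistribMulAction.toMulAction.toSMul r x

/-- `i` is the loop-module `R`-action: a homogeneous element `r ∈ R_g` acts on
`v ⊗ a` by `r • (v ⊗ a) = (r v) ⊗ (p g + a)`; in terms of values of finitely
supported functions, `(r • x) a = r • x (a - p g)`. -/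
def IsLoopSMul [AddCommGroup Q₁] (𝒜 : AlgebraGrading F G R) (p : G →+ Q₁)
    (s : Q₁ → Q₂) {V : Type*} [AddCommGroup V] [Module F V] [Module R V]
    (ℳ : Q₂ → Submodule F V) (i : Module R ↥(LoopSubmodule s ℳ)) : Prop :=
  ∀ {g : G} {r : R}, r ∈ 𝒜.comp g → ∀ (x : ↥(LoopSubmodule s ℳ)) (a : Q₁),
    ((msmul i r x : ↥(LoopSubmodule s ℳ)) : Q₁ →₀ V) a = r • ((x : Q₁ →₀ V) (a - p g))

/-- The right-shift operator `1 ⊗ d` on the loop module: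
`v ⊗ a ↦ v ⊗ (a + d)`. -/
def rshiftFun [AddCommGroup Q₁] {V : Type*} [AddCommGroup V] [Module F V]
    (s : Q₁ → Q₂) (ℳ : Q₂ → Submodule F V) (d : Q₁) (hd : ∀ a, s (a + d) = s a) :
    ↥(LoopSubmodule s ℳ) → ↥(LoopSubmodule s ℳ) :=
  fun x => ⟨Finsupp.equivMapDomain (Equiv.addRight d) (x : Q₁ →₀ V), by
    intro a
    have key : Finsupp.equivMapDomain (Equiv.addRight d) (x : Q₁ →₀ V) a
        = (x : Q₁ →₀ V) (a - d) := by
      rw [Finsupp.equivMapDomain_apply]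
      congr 1
      simp [sub_eq_add_neg]
    rw [key]
    have h1 : s (a - d) = s a := by
      have h2 := hd (a - d)
      rw [show a - d + d = a by abel] at h2
      exact h2.symm
    exact h1 ▸ x.2 (a - d)⟩

end Loop

section Twist

variable (H : AddSubgroup G)

/-- `i` is the `R`-module structure on (the finitely-supported-functions model
`{f : G/H →₀ V | f q ∈ V_q}` of) the `G/H`-graded module `V`, twisted by the
scalar factors `cf`: a homogeneous `r ∈ R_g` acts on `v ∈ V_k` by
`r • v = cf g k • (r v) ∈ V_{ḡ + k}`. -/
def IsTwistedSMul (𝒜 : AlgebraGrading F G R) {V : Type*} [AddCommGroup V]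
    [Module F V] [Module R V] (ℳ : G ⧸ H → Submodule F V) (cf : G → G ⧸ H → F)
    (i : Module R ↥(LoopSubmodule (id : G ⧸ H → G ⧸ H) ℳ)) : Prop :=
  ∀ {g : G} {r : R}, r ∈ 𝒜.comp g → ∀ (x : ↥(LoopSubmodule (id : G ⧸ H → G ⧸ H) ℳ))
    (q : G ⧸ H),
    ((msmul i r x : ↥(LoopSubmodule (id : G ⧸ H → G ⧸ H) ℳ)) : (G ⧸ H) →₀ V) q
      = cf g (q - QuotientAddGroup.mk g) •
          (r • ((x : (G ⧸ H) →₀ V) (q - QuotientAddGroup.mk g)))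

end Twist

section Pregrading

/-- A `G`-pregrading of the left `R`-module `V`: a family of subspaces with
`V = Σ_g V_g` and `R_g · V_h ⊆ V_{g+h}`. -/
def IsPregrading (𝒜 : AlgebraGrading F G R) {V : Type*} [AddCommGroup V]
    [Module F V] [Module R V] (P : G → Submodule F V) : Prop :=
  (⨆ g, P g) = (⊤ : Submodule F V) ∧
  ∀ {g k : G} {r : R} {v : V}, r ∈ 𝒜.comp g → v ∈ P k → r • v ∈ P (g + k)

/-- A pregrading is thin if it admits no proper refinement. -/
def IsThinPregrading (𝒜 : AlgebraGrading F G R) {V : Type*} [AddCommGroup V]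
    [Module F V] [Module R V] (P : G → Submodule F V) : Prop :=
  IsPregrading 𝒜 P ∧
  ∀ P' : G → Submodule F V, IsPregrading 𝒜 P' → (∀ g, P' g ≤ P g) → P' = P

end Pregrading

section Extras

open TensorProduct

variable {G : Type*} [AddCommGroup G] {R : Type*} [Ring R] [Algebra F R]

lemma mk'_add_right_mem (H : AddSubgroup G) (h : ↥H) (a : G) :
    (QuotientAddGroup.mk' H) (a + (h : G)) = (QuotientAddGroup.mk' H) a := by
  simpa using QuotientAddGroup.mk_add_of_mem a h.2

/-- The right-shift operator `1 ⊗ h`, `h ∈ H`, on the loop module `L_π(V)`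
(for `π : G → G/H` the natural projection): `v ⊗ g ↦ v ⊗ (g + h)`. -/
def loopShift (H : AddSubgroup G) {V : Type*} [AddCommGroup V] [Module F V]
    (ℳ : G ⧸ H → Submodule F V) (h : ↥H) :
    ↥(LoopSubmodule (⇑(QuotientAddGroup.mk' H)) ℳ) →
      ↥(LoopSubmodule (⇑(QuotientAddGroup.mk' H)) ℳ) :=
  rshiftFun (⇑(QuotientAddGroup.mk' H)) ℳ (h : G) (mk'_add_right_mem H h)

lemma twist_elt_mem (H : AddSubgroup G) (ξ : G ⧸ H → G)
    (hξ : ∀ q, (QuotientAddGroup.mk' H) (ξ q) = q) (g : G) (k : G ⧸ H) :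
    g + ξ k - ξ ((QuotientAddGroup.mk' H) g + k) ∈ H := by
  have h0 : (QuotientAddGroup.mk' H) (g + ξ k - ξ ((QuotientAddGroup.mk' H) g + k)) = 0 := by
    rw [map_sub, map_add, hξ, hξ]
    abel
  exact (QuotientAddGroup.eq_zero_iff _).mp h0

/-- The scalar factors `χ(g + ξ(k̄) - ξ(ḡ + k̄))` defining the module `V`
twisted by a character `χ` of `H`, relative to the section `ξ` of the natural
projection `π : G → G/H`. -/
def twistFactor (H : AddSubgroup G) (ξ : G ⧸ H → G)
    (hξ : ∀ q, (QuotientAddGroup.mk' H) (ξ q) = q) (χ : AddChar ↥H Fˣ) :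
    G → G ⧸ H → F :=
  fun g k =>
    ((χ ⟨g + ξ k - ξ ((QuotientAddGroup.mk' H) g + k), twist_elt_mem H ξ hξ g k⟩ : Fˣ) : F)

/-- The `G/H`-grading induced on a quotient `W/N` of a `G`-graded module `W`:
the component of degree `ḡ` is the image of `⊕_{h ∈ H} W_{g+h}`. -/
def quotGradeComp {W : Type*} [AddCommGroup W] [Module F W] [Module R W]
    [IsScalarTower F R W] (H : AddSubgroup G) (ℳ : G → Submodule F W)
    (N : Submodule R W) : G ⧸ H → Submodule F (W ⧸ N) :=
  fun q => ⨆ g : {g : G // (QuotientAddGroup.mk' H) g = q},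
    (ℳ (g : G)).map ((N.mkQ).restrictScalars F)

/-- The submodule `W · ker ρ` of `W`, where `ρ` is the homomorphism of unital
algebras `𝓕 → F` determined by `ρ(c_h) = ρ h` on the multiplicative
homogeneous basis `c` of the graded subfield `𝓕 ≅ FH` of the centralizer:
`W · ker ρ = Σ_{h ∈ H} W·(c_h - ρ(h)·1)`. -/
def kerSubmodule {W : Type*} [AddCommGroup W] [Module F W] [Module R W]
    [SMulCommClass R F W] {H : AddSubgroup G} (c : ↥H → Module.End R W)
    (ρ : ↥H → F) : Submodule R W :=
  ⨆ h : ↥H, LinearMap.range (c h - ρ h • (1 : Module.End R W))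

/-- The grading of the coordinate space `ι' → F` with coordinates of degrees
`gdeg`. -/
def coordComp {ι' : Type*} (gdeg : ι' → G) (g : G) : Submodule F (ι' → F) where
  carrier := {x | ∀ i, gdeg i ≠ g → x i = 0}
  add_mem' := fun hx hy i hi => by
    simp only [Pi.add_apply, hx i hi, hy i hi, add_zero]
  zero_mem' := fun i hi => rfl
  smul_mem' := fun a x hx i hi => by
    simp only [Pi.smul_apply, hx i hi, smul_zero]

/-- The natural grading of a tensor product of two graded algebras (or graded
vector spaces): the component of degree `g` is spanned by the products
`a ⊗ b` of homogeneous elements with `deg a + deg b = g`. -/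
def tensorGradeComp {A B : Type*} [AddCommGroup A] [Module F A] [AddCommGroup B]
    [Module F B] (Ac : G → Submodule F A) (Bc : G → Submodule F B) (g : G) :
    Submodule F (A ⊗[F] B) :=
  Submodule.span F {x | ∃ (g₁ g₂ : G) (a : A) (b : B),
    g₁ + g₂ = g ∧ a ∈ Ac g₁ ∧ b ∈ Bc g₂ ∧ x = a ⊗ₜ[F] b}

/-- The action of `r ∈ R` on an `R`-module `V`, viewed as an `F`-linear
endomorphism of `V`; i.e. the representation `R → End_F(V)`. -/
def actionEnd (F : Type*) [Field F] {R V : Type*} [Ring R] [AddCommGroup V]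
    [Module F V] [Module R V] [SMulCommClass R F V] (r : R) : Module.End F V where
  toFun v := r • v
  map_add' := smul_add r
  map_smul' a v := by simpa using smul_comm r a v

end Extras

end GradedPaper

namespace GradedPaper

/-- The corner `A·ε` of an algebra determined by a central idempotent `ε`:
`{x | xε = x = εx}`, an `F`-subspace. -/
def cornerSubmodule {F : Type*} [Field F] {A : Type*} [Ring A] [Algebra F A]
    (ε : A) : Submodule F A where
  carrier := {x | x * ε = x ∧ ε * x = x}
  add_mem' := by
    rintro x y ⟨hx1, hx2⟩ ⟨hy1, hy2⟩
    constructor <;> simp [add_mul, mul_add, hx1, hx2, hy1, hy2]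
  zero_mem' := by simp
  smul_mem' := by
    rintro a x ⟨hx1, hx2⟩
    constructor <;> simp [Algebra.smul_mul_assoc, Algebra.mul_smul_comm, hx1, hx2]

/-- The `G/Z`-grading of the corner `D·ε` of the centralizer `D = C(W)`:
`(Dε)_{gZ} = D_g · ε`. -/
def cornerGrading {F : Type*} [Field F] {G : Type*} [AddCommGroup G]
    {R : Type*} [Ring R] [Algebra F R]
    {W : Type*} [AddCommGroup W] [Module F W] [Module R W] [IsScalarTower F R W]
    [SMulCommClass R F W] (Z : AddSubgroup G) (ℳ : G → Submodule F W)
    (ε : Module.End R W) : G ⧸ Z → Submodule F (Module.End R W) :=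
  fun q => ⨆ g : {g : G // (QuotientAddGroup.mk' Z) g = q},
    Submodule.map (LinearMap.mulRight F ε) (homogComp ℳ (g : G))

lemma IsVSDecomp.induct {F V ι : Type*} [Field F] [AddCommGroup V] [Module F V]
    {ℳ : ι → Submodule F V} (h : IsVSDecomp ℳ) {p : V → Prop} (h0 : p 0)
    (hadd : ∀ x y, p x → p y → p (x + y)) (hhom : ∀ i, ∀ x ∈ ℳ i, p x) (v : V) : p v := by
  obtain ⟨t, c, hc, rfl⟩ := h.1 v
  exact Finset.sum_induction _ p hadd h0 (fun i hi => hhom i _ (hc i hi))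

lemma IsVSDecomp.isInternal {F V ι : Type*} [Field F] [AddCommGroup V] [Module F V]
    [DecidableEq ι] {ℳ : ι → Submodule F V} (h : IsVSDecomp ℳ) : DirectSum.IsInternal ℳ := by
  rw [DirectSum.isInternal_submodule_iff_iSupIndep_and_iSup_eq_top]
  refine ⟨(iSupIndep_iff_finsetSum_eq_zero_imp_eq_zero ℳ).2 h.2, ?_⟩
  rw [eq_top_iff]
  intro v _
  obtain ⟨t, c, hc, rfl⟩ := h.1 v
  exact Submodule.sum_mem _ (fun i hi => Submodule.mem_iSup_of_mem i (hc i hi))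

lemma IsVSDecomp.glue {F V ι N : Type*} [Field F] [AddCommGroup V] [Module F V]
    [AddCommGroup N] [Module F N]
    {ℳ : ι → Submodule F V} (h : IsVSDecomp ℳ) (L : ι → V →ₗ[F] N) :
    ∃ Φ : V →ₗ[F] N, ∀ i, ∀ v ∈ ℳ i, Φ v = L i v := by
  classical
  letI := h.isInternal.chooseDecomposition
  refine ⟨(DirectSum.toModule F ι N (fun i => (L i).comp (ℳ i).subtype)).comp
    (DirectSum.decomposeLinearEquiv ℳ).toLinearMap, fun i v hv => ?_⟩
  simp only [LinearMap.comp_apply, LinearEquiv.coe_coe, DirectSum.decomposeLinearEquiv_apply]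
  rw [DirectSum.decompose_of_mem ℳ hv]
  erw [DirectSum.toModule_lof]
  rfl

lemma IsVSDecomp.exists_proj {F V ι : Type*} [Field F] [AddCommGroup V] [Module F V]
    {ℳ : ι → Submodule F V} (h : IsVSDecomp ℳ) :
    ∃ π : ι → V →ₗ[F] V, (∀ i, ∀ v ∈ ℳ i, π i v = v) ∧
      (∀ i j, i ≠ j → ∀ v ∈ ℳ i, π j v = 0) ∧ (∀ i v, π i v ∈ ℳ i) ∧
      (∀ v, ∃ t : Finset ι, (∀ i, i ∉ t → π i v = 0) ∧ v = ∑ i ∈ t, π i v) := by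
  classical
  have H : ∀ j, ∃ Φ : V →ₗ[F] V, ∀ i, ∀ v ∈ ℳ i, Φ v = (if i = j then LinearMap.id else 0 : V →ₗ[F] V) v :=
    fun j => h.glue (fun i => if i = j then LinearMap.id else 0)
  choose π hπ using H
  have h1 : ∀ i, ∀ v ∈ ℳ i, π i v = v := fun i v hv => by simp [hπ i i v hv]
  have h2 : ∀ i j, i ≠ j → ∀ v ∈ ℳ i, π j v = 0 := fun i j hij v hv => by
    simp [hπ j i v hv, hij]
  refine ⟨π, h1, h2, ?_, ?_⟩
  · intro i v
    refine h.induct (p := fun v => π i v ∈ ℳ i) ?_ ?_ ?_ v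
    · simp
    · intro x y hx hy
      rw [map_add]; exact add_mem hx hy
    · intro j x hx
      by_cases hij : j = i
      · subst hij; rw [h1 _ _ hx]; exact hx
      · rw [h2 _ _ hij x hx]; exact zero_mem _
  · intro v
    obtain ⟨t, c, hc, rfl⟩ := h.1 v
    have key : ∀ i, π i (∑ k ∈ t, c k) = if i ∈ t then c i else 0 := by
      intro i
      rw [map_sum]
      have : ∀ k ∈ t, π i (c k) = if i = k then c k else 0 := by
        intro k hk
        by_cases hik : i = k
        · subst hik; simp [h1 _ _ (hc _ hk)]
        · simp [hik, h2 k i (Ne.symm hik) _ (hc _ hk)]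
      rw [Finset.sum_congr rfl this, Finset.sum_ite_eq]
    refine ⟨t, fun i hi => by rw [key, if_neg hi], ?_⟩
    refine Finset.sum_congr rfl (fun i hi => ?_)
    rw [key, if_pos hi]

/-- Graded division algebra. -/
structure GDA {F : Type*} [Field F] {G : Type*} [AddCommGroup G] {A : Type*} [Ring A]
    [Algebra F A] (𝒟 : G → Submodule F A) : Prop where
  decomp : IsVSDecomp 𝒟
  one_mem : (1 : A) ∈ 𝒟 0
  mul_mem : ∀ {g h : G} {r s : A}, r ∈ 𝒟 g → s ∈ 𝒟 h → r * s ∈ 𝒟 (g + h)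
  inv : ∀ {g : G} {x : A}, x ∈ 𝒟 g → x ≠ 0 → ∃ y ∈ 𝒟 (-g), x * y = 1 ∧ y * x = 1

section Phase1
variable {F : Type*} [Field F] {G : Type*} [AddCommGroup G]
    {R : Type*} [Ring R] [Algebra F R]
    {W : Type*} [AddCommGroup W] [Module F W] [Module R W] [IsScalarTower F R W]
    [SMulCommClass R F W]

lemma graded_of_proj {ℳ : G → Submodule F W} {π : G → W →ₗ[F] W}
    (h3 : ∀ i v, π i v ∈ ℳ i)
    (h4 : ∀ v, ∃ t : Finset G, (∀ i, i ∉ t → π i v = 0) ∧ v = ∑ i ∈ t, π i v)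
    (N : Submodule R W) (hN : ∀ v ∈ N, ∀ i, π i v ∈ N) : IsGradedSubmodule ℳ N := by
  intro w hw
  obtain ⟨t, -, ht⟩ := h4 w
  exact ⟨t, fun i => π i w, fun i _ => ⟨h3 i w, hN w hw i⟩, ht⟩

lemma proj_smul (𝒜 : AlgebraGrading F G R) (𝒲 : ModuleGrading 𝒜 (AddMonoidHom.id G) W)
    {π : G → W →ₗ[F] W} (h1 : ∀ i, ∀ v ∈ 𝒲.comp i, π i v = v)
    (h2 : ∀ i j, i ≠ j → ∀ v ∈ 𝒲.comp i, π j v = 0)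
    {g : G} {r : R} (hr : r ∈ 𝒜.comp g) (k : G) (v : W) :
    π (g + k) (r • v) = r • π k v := by
  refine 𝒲.decomp.induct (p := fun v => π (g + k) (r • v) = r • π k v) ?_ ?_ ?_ v
  · simp
  · intro x y hx hy
    rw [smul_add, map_add, hx, hy, map_add, smul_add]
  · intro i x hx
    have := 𝒲.smul_mem hr hx
    simp only [AddMonoidHom.id_apply] at this
    by_cases hik : i = k
    · subst hik
      rw [h1 _ _ this, h1 _ _ hx]
    · rw [h2 _ _ _ _ this, h2 _ _ hik _ hx, smul_zero]
      simpa using hik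

lemma proj_end {ℳ : G → Submodule F W} (hd : IsVSDecomp ℳ)
    {π : G → W →ₗ[F] W} (h1 : ∀ i, ∀ v ∈ ℳ i, π i v = v)
    (h2 : ∀ i j, i ≠ j → ∀ v ∈ ℳ i, π j v = 0)
    {d : G} {f : Module.End R W} (hf : IsHomogeneousEnd ℳ d f) (k : G) (v : W) :
    π (k + d) (f v) = f (π k v) := by
  refine hd.induct (p := fun v => π (k + d) (f v) = f (π k v)) ?_ ?_ ?_ v
  · simp
  · intro x y hx hy
    rw [map_add, map_add, hx, hy, map_add, map_add]
  · intro i x hx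
    have := hf hx
    by_cases hik : i = k
    · subst hik
      rw [h1 _ _ this, h1 _ _ hx]
    · rw [h2 _ _ _ _ this, h2 _ _ hik _ hx, map_zero]
      simpa using hik

lemma exists_generator (𝒜 : AlgebraGrading F G R) (𝒲 : ModuleGrading 𝒜 (AddMonoidHom.id G) W)
    (hsimple : IsGradedSimpleModule R 𝒲.comp) :
    ∃ (k : G) (w : W), w ∈ 𝒲.comp k ∧ ∀ v, ∃ r : R, v = r • w := by
  obtain ⟨π, h1, h2, h3, h4⟩ := 𝒲.decomp.exists_proj
  obtain ⟨⟨v0, hv0⟩, hs⟩ := hsimple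
  obtain ⟨k, hk⟩ : ∃ k, π k v0 ≠ 0 := by
    by_contra! hcon
    obtain ⟨t, -, ht⟩ := h4 v0
    exact hv0 (by rw [ht]; exact Finset.sum_eq_zero (fun i _ => hcon i))
  refine ⟨k, π k v0, h3 _ _, ?_⟩
  set w := π k v0 with hw
  have hN : IsGradedSubmodule 𝒲.comp (Submodule.span R {w}) := by
    refine graded_of_proj h3 h4 _ ?_
    intro v hv i
    obtain ⟨r, rfl⟩ := Submodule.mem_span_singleton.1 hv
    refine 𝒜.decomp.induct (p := fun r => π i (r • w) ∈ Submodule.span R {w}) ?_ ?_ ?_ r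
    · simp
    · intro x y hx hy
      rw [add_smul, map_add]; exact add_mem hx hy
    · intro g r hr
      have hm := 𝒲.smul_mem hr (h3 k v0)
      by_cases hik : (AddMonoidHom.id G) g + k = i
      · subst hik
        rw [h1 _ _ hm]
        exact Submodule.smul_mem _ _ (Submodule.mem_span_singleton_self _)
      · rw [h2 _ _ hik _ hm]; exact zero_mem _
  rcases hs _ hN with h | h
  · exact absurd (Submodule.span_singleton_eq_bot.1 h) hk
  · intro v
    have : v ∈ Submodule.span R {w} := by rw [h]; trivial
    obtain ⟨r, hr⟩ := Submodule.mem_span_singleton.1 this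
    exact ⟨r, hr.symm⟩

lemma homogComp_decomp (𝒜 : AlgebraGrading F G R) (𝒲 : ModuleGrading 𝒜 (AddMonoidHom.id G) W)
    (hsimple : IsGradedSimpleModule R 𝒲.comp) :
    IsVSDecomp (homogComp (R := R) 𝒲.comp) := by
  classical
  obtain ⟨π, h1, h2, h3, h4⟩ := 𝒲.decomp.exists_proj
  constructor
  · intro f
    -- the homogeneous components of `f`
    have H : ∀ d : G, ∃ φ : Module.End R W, ∀ k, ∀ v ∈ 𝒲.comp k, φ v = π (k + d) (f v) := by
      intro d
      obtain ⟨Φ, hΦ⟩ := 𝒲.decomp.glue (fun k => (π (k + d)).comp (f.restrictScalars F))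
      have hΦ' : ∀ k, ∀ v ∈ 𝒲.comp k, Φ v = π (k + d) (f v) := fun k v hv => by
        rw [hΦ k v hv]; rfl
      refine ⟨{ toFun := Φ, map_add' := map_add Φ, map_smul' := ?_ }, hΦ'⟩
      intro r v
      simp only [RingHom.id_apply]
      refine 𝒲.decomp.induct (p := fun v => Φ (r • v) = r • Φ v) ?_ ?_ ?_ v
      · simp
      · intro x y hx hy
        rw [smul_add, map_add, hx, hy, map_add, smul_add]
      · intro k v hv
        refine 𝒜.decomp.induct (p := fun r => Φ (r • v) = r • Φ v) ?_ ?_ ?_ r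
        · simp
        · intro x y hx hy
          rw [add_smul, map_add, hx, hy, add_smul]
        · intro g r hr
          have hm := 𝒲.smul_mem hr hv
          simp only [AddMonoidHom.id_apply] at hm
          rw [hΦ' _ _ hm, hΦ' _ _ hv, map_smul, add_assoc, proj_smul 𝒜 𝒲 h1 h2 hr]
    choose φ hφ using H
    obtain ⟨k, w, hw, hgen⟩ := exists_generator 𝒜 𝒲 hsimple
    obtain ⟨t, ht0, ht⟩ := h4 (f w)
    refine ⟨t.image (fun i => i - k), φ, ?_, ?_⟩
    · intro d _ j v hv
      rw [hφ d j v hv]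
      exact h3 _ _
    · ext v
      obtain ⟨r, rfl⟩ := hgen v
      rw [map_smul, map_smul]
      congr 1
      rw [LinearMap.sum_apply, Finset.sum_image (by intro a _ b _ h; simpa using h)]
      conv_lhs => rw [ht]
      refine Finset.sum_congr rfl (fun i _ => ?_)
      rw [hφ _ k w hw, add_sub_cancel]
  · intro t c hc hsum d hd
    ext v
    rw [LinearMap.zero_apply]
    refine 𝒲.decomp.induct (p := fun v => c d v = 0) (map_zero _) ?_ ?_ v
    · intro x y hx hy
      rw [map_add, hx, hy, add_zero]
    · intro k x hx
      have e : ∑ d ∈ t, c d x = 0 := by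
        rw [← LinearMap.sum_apply, hsum, LinearMap.zero_apply]
      have := congrArg (π (k + d)) e
      rw [map_sum, map_zero, Finset.sum_eq_single d] at this
      · rwa [h1 _ _ (hc d hd hx)] at this
      · intro b hb hbd
        exact h2 _ _ (by simpa using hbd) _ (hc b hb hx)
      · exact fun h => absurd hd h

lemma homogComp_gda (𝒜 : AlgebraGrading F G R) (𝒲 : ModuleGrading 𝒜 (AddMonoidHom.id G) W)
    (hsimple : IsGradedSimpleModule R 𝒲.comp) :
    GDA (homogComp (R := R) 𝒲.comp) where
  decomp := homogComp_decomp 𝒜 𝒲 hsimple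
  one_mem := by
    intro k v hv
    simpa using hv
  mul_mem := by
    intro g h r s hr hs k v hv
    have := hr (hs hv)
    rw [add_assoc, add_comm h g] at this
    exact this
  inv := by
    intro d f hf hf0
    have hf' : IsHomogeneousEnd 𝒲.comp d f := hf
    obtain ⟨π, h1, h2, h3, h4⟩ := 𝒲.decomp.exists_proj
    have hker : LinearMap.ker f = ⊥ := by
      have hN : IsGradedSubmodule 𝒲.comp (LinearMap.ker f) := by
        refine graded_of_proj h3 h4 _ ?_
        intro v hv i
        rw [LinearMap.mem_ker] at hv ⊢
        rw [← proj_end 𝒲.decomp h1 h2 hf', hv, map_zero]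
      rcases hsimple.2 _ hN with h | h
      · exact h
      · exact absurd (LinearMap.ker_eq_top.1 h) hf0
    have hran : LinearMap.range f = ⊤ := by
      have hN : IsGradedSubmodule 𝒲.comp (LinearMap.range f) := by
        refine graded_of_proj h3 h4 _ ?_
        rintro _ ⟨v, rfl⟩ i
        refine ⟨π (i - d) v, ?_⟩
        rw [← proj_end 𝒲.decomp h1 h2 hf', sub_add_cancel]
      rcases hsimple.2 _ hN with h | h
      · exact absurd (LinearMap.range_eq_bot.1 h) hf0
      · exact h
    let e : W ≃ₗ[R] W := LinearEquiv.ofBijective f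
      ⟨LinearMap.ker_eq_bot.1 hker, LinearMap.range_eq_top.1 hran⟩
    have he : ∀ v, f (e.symm v) = v := fun v => e.apply_symm_apply v
    have he' : ∀ v, e.symm (f v) = v := fun v => e.symm_apply_apply v
    refine ⟨e.symm.toLinearMap, ?_, ?_, ?_⟩
    · intro k v hv
      change e.symm v ∈ _
      have : π (k + -d) (e.symm v) = e.symm v := by
        apply LinearMap.ker_eq_bot.1 hker
        rw [← proj_end 𝒲.decomp h1 h2 hf', he, neg_add_cancel_right, h1 _ _ hv]
      rw [← this]
      exact h3 _ _
    · ext v; exact he v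
    · ext v; exact he' v

end Phase1

lemma card_mult (K : Type*) : Nat.card (Multiplicative K) = Nat.card K :=
  Nat.card_congr Multiplicative.toAdd

lemma enough_roots (F : Type*) [Field F] [IsAlgClosed F] (K : Type*) [Group K] 
    (hK : (Nat.card K : F) ≠ 0) : HasEnoughRootsOfUnity F (Monoid.exponent K) := by
  have : NeZero ((Monoid.exponent K : ℕ) : F) := ⟨by
    intro h
    obtain ⟨m, hm⟩ := Group.exponent_dvd_nat_card (G := K)
    apply hK
    rw [hm, Nat.cast_mul, h, zero_mul]⟩
  infer_instance

section chars
variable {F : Type*} [Field F] [IsAlgClosed F] {K : Type*} [AddCommGroup K] [Finite K]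

lemma finite_chars (hK : (Nat.card K : F) ≠ 0) : Finite (Multiplicative K →* Fˣ) := by
  have := enough_roots F (Multiplicative K) (by rwa [card_mult])
  infer_instance

lemma charsum (hK : (Nat.card K : F) ≠ 0) [Fintype (Multiplicative K →* Fˣ)] (k : K) (hk : k ≠ 0) :
    ∑ χ : Multiplicative K →* Fˣ, ((χ (Multiplicative.ofAdd k) : Fˣ) : F) = 0 := by
  have := enough_roots F (Multiplicative K) (by rwa [card_mult])
  obtain ⟨φ, hφ⟩ := CommGroup.exists_apply_ne_one_of_hasEnoughRootsOfUnity (Multiplicative K) F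
    (a := Multiplicative.ofAdd k) (by simpa using hk)
  have h : ∑ χ : Multiplicative K →* Fˣ, ((χ (Multiplicative.ofAdd k) : Fˣ) : F)
     = ∑ χ : Multiplicative K →* Fˣ, (((φ * χ) (Multiplicative.ofAdd k) : Fˣ) : F) :=
    (Equiv.sum_comp (Equiv.mulLeft φ) (fun χ => ((χ (Multiplicative.ofAdd k) : Fˣ) : F))).symm
  simp only [MonoidHom.mul_apply, Units.val_mul, ← Finset.mul_sum] at h
  by_contra h0
  apply hφ
  have := mul_right_cancel₀ h0 ((one_mul _).trans h)
  exact Units.ext this.symm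

lemma charcard (hK : (Nat.card K : F) ≠ 0) [Fintype (Multiplicative K →* Fˣ)] :
    Fintype.card (Multiplicative K →* Fˣ) = Nat.card K := by
  have := enough_roots F (Multiplicative K) (by rwa [card_mult])
  rw [← Nat.card_eq_fintype_card, CommGroup.card_monoidHom_of_hasEnoughRootsOfUnity, card_mult]

/-- projection to the eigenspace -/
def eproj [Fintype K] {V : Type*} [AddCommGroup V] [Module F V] (ρ : K → V → V)
    (χ : Multiplicative K →* Fˣ) (v : V) : V :=
  (Nat.card K : F)⁻¹ • ∑ k : K, ((χ (Multiplicative.ofAdd (-k)) : Fˣ) : F) • ρ k v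

lemma eproj_eigen [Fintype K] {V : Type*} [AddCommGroup V] [Module F V] (ρ : K → V →ₗ[F] V)
    (hadd : ∀ a b v, ρ (a + b) v = ρ a (ρ b v))
    (χ : Multiplicative K →* Fˣ) (v : V) (k : K) :
    ρ k (eproj (fun k => ρ k) χ v) =
      ((χ (Multiplicative.ofAdd k) : Fˣ) : F) • eproj (fun k => ρ k) χ v := by
  unfold eproj
  rw [map_smul, smul_comm, map_sum]
  congr 1
  rw [Finset.smul_sum]
  rw [← Equiv.sum_comp (Equiv.addLeft k)
    (fun j => ((χ (Multiplicative.ofAdd k) : Fˣ) : F) •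
      ((χ (Multiplicative.ofAdd (-j)) : Fˣ) : F) • ρ j v)]
  refine Finset.sum_congr rfl (fun j _ => ?_)
  simp only [Equiv.coe_addLeft]
  rw [map_smul, hadd, smul_smul, ← Units.val_mul, ← map_mul, ← ofAdd_add]
  congr 5
  abel

lemma eproj_sum [Fintype K] (hK : (Nat.card K : F) ≠ 0) [Fintype (Multiplicative K →* Fˣ)]
    {V : Type*} [AddCommGroup V] [Module F V] (ρ : K → V → V)
    (h0 : ∀ v, ρ 0 v = v) (v : V) :
    ∑ χ : Multiplicative K →* Fˣ, eproj ρ χ v = v := by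
  unfold eproj
  rw [← Finset.smul_sum, Finset.sum_comm]
  simp_rw [← Finset.sum_smul]
  rw [Finset.sum_eq_single (0 : K)]
  · simp only [neg_zero, ofAdd_zero, map_one, Units.val_one, h0, Finset.sum_const, Finset.card_univ,
      charcard hK, nsmul_eq_mul, mul_one]
    rw [smul_smul, inv_mul_cancel₀ hK, one_smul]
  · intro k _ hk
    rw [charsum hK (-k) (by simpa using hk), zero_smul]
  · simp

end chars

lemma card_le_of_chars {F : Type*} [Field F] {B X : Type*} [Monoid B] [Finite B]
    (φ : X → (B →* F)) (hφ : Function.Injective φ) : Finite X ∧ Nat.card X ≤ Nat.card B := by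
  have li : LinearIndependent F (fun x => (φ x : B → F)) :=
    (linearIndependent_monoidHom B F).comp φ hφ
  have hX : Finite X := li.finite
  have := Fintype.ofFinite X
  have := Fintype.ofFinite B
  refine ⟨hX, ?_⟩
  have := li.fintype_card_le_finrank
  rwa [Module.finrank_fintype_fun_eq_card, ← Nat.card_eq_fintype_card, ← Nat.card_eq_fintype_card]
    at this

lemma pairing_half {F : Type*} [Field F] {A B : Type*} [AddCommGroup A] [AddCommGroup B]
    (b : A →+ B →+ Additive Fˣ) (hfin : Finite (B ⧸ b.flip.ker)) :
    Finite (A ⧸ b.ker) ∧ Nat.card (A ⧸ b.ker) ≤ Nat.card (B ⧸ b.flip.ker) := by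
  have hk : ∀ a, b.flip.ker ≤ (b a).ker := by
    intro a x hx
    have : b.flip x = 0 := hx
    rw [AddMonoidHom.mem_ker, ← AddMonoidHom.flip_apply, this, AddMonoidHom.zero_apply]
  let ψ : A → (B ⧸ b.flip.ker →+ Additive Fˣ) := fun a => QuotientAddGroup.lift _ (b a) (hk a)
  let φ : A ⧸ b.ker → (Multiplicative (B ⧸ b.flip.ker) →* F) := fun q =>
    (Units.coeHom F).comp (AddMonoidHom.toMultiplicativeLeft (ψ q.out))
  have := card_le_of_chars φ (by
    intro q q' h
    have h1 : b q.out = b q'.out := by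
      ext x
      have := DFunLike.congr_fun h (Multiplicative.ofAdd (QuotientAddGroup.mk x))
      have h2 : ((b q.out x).toMul : F) = ((b q'.out x).toMul : F) := this
      exact h2
    rw [← QuotientAddGroup.out_eq' q, ← QuotientAddGroup.out_eq' q', QuotientAddGroup.eq]
    simp [AddMonoidHom.mem_ker, h1])
  rwa [card_mult] at this

lemma pairing_index {F : Type*} [Field F] {A B : Type*} [AddCommGroup A] [AddCommGroup B]
    (b : A →+ B →+ Additive Fˣ) (hfin : Finite (B ⧸ b.flip.ker)) :
    Finite (A ⧸ b.ker) ∧ b.ker.index = b.flip.ker.index := by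
  obtain ⟨h1, h2⟩ := pairing_half b hfin
  obtain ⟨h3, h4⟩ := pairing_half b.flip h1
  exact ⟨h1, le_antisymm h2 h4⟩

lemma extend_char {F : Type*} [Field F] [IsAlgClosed F] {T : Type*} [AddCommGroup T] [Finite T]
    (hT : (Nat.card T : F) ≠ 0) (Z : AddSubgroup T) (χ : Z →+ Additive Fˣ) :
    ∃ ψ : T →+ Additive Fˣ, ∀ z : Z, ψ z = χ z := by
  have := enough_roots F (Multiplicative T) (by rwa [card_mult])
  obtain ⟨ψ, hψ⟩ := MonoidHom.domRestrict_surjective F (AddSubgroup.toSubgroup Z)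
    (AddMonoidHom.toMultiplicativeLeft χ)
  refine ⟨MonoidHom.toAdditiveRight ψ, fun z => ?_⟩
  have := DFunLike.congr_fun hψ ⟨Multiplicative.ofAdd (z : T), z.2⟩
  exact this

/-- The abstract setting: a graded division algebra with a multiplicative family `c` spanning a
self-centralizing graded subfield. -/
structure Setup {F : Type*} [Field F] {G : Type*} [AddCommGroup G] {A : Type*} [Ring A]
    [Algebra F A] (𝒟 : G → Submodule F A) (H : AddSubgroup G) (c : ↥H → A) : Prop where
  gda : GDA 𝒟
  fin : Finite ↥H
  card : (Nat.card ↥H : F) ≠ 0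
  c0 : c 0 = 1
  chom : ∀ h : ↥H, c h ∈ 𝒟 (h : G)
  cmul : ∀ h₁ h₂ : ↥H, c (h₁ + h₂) = c h₁ * c h₂
  centr : ∀ (g : G) (f : A), f ∈ 𝒟 g → (∀ h, c h * f = f * c h) →
    ∃ (h : ↥H) (a : F), (h : G) = g ∧ f = a • c h

lemma centr_of_max {F : Type*} [Field F] {G : Type*} [AddCommGroup G] {A : Type*} [Ring A]
    [Algebra F A] {𝒟 : G → Submodule F A} {H : AddSubgroup G} {c : ↥H → A} (hD : GDA 𝒟)
    (chom : ∀ h : ↥H, c h ∈ 𝒟 (h : G))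
    (cmul : ∀ h₁ h₂ : ↥H, c (h₁ + h₂) = c h₁ * c h₂)
    (hmax : ∀ 𝒦 : GradedSubfield 𝒟,
      (∀ h : ↥H, c h ∈ 𝒦.comp ((h : G))) →
      ∀ (g : G) (f : A), f ∈ 𝒦.comp g →
        ∃ (h : ↥H) (a : F), (h : G) = g ∧ f = a • c h) (g : G) (f : A) (hf : f ∈ 𝒟 g)
    (hcf : ∀ h, c h * f = f * c h) : ∃ (h : ↥H) (a : F), (h : G) = g ∧ f = a • c h := by
  let S : Set A := insert f (Set.range c)
  have hcc : ∀ h k, c h * c k = c k * c h := fun h k => by rw [← cmul, ← cmul, add_comm]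
  have hS : ∀ x ∈ S, ∀ y ∈ S, x * y = y * x := by
    rintro x (rfl | ⟨h, rfl⟩) y (rfl | ⟨k, rfl⟩)
    · rfl
    · exact (hcf k).symm
    · exact hcf h
    · exact hcc h k
  let B : Subalgebra F A := Subalgebra.centralizer F (Subalgebra.centralizer F S : Set A)
  have hB : ∀ x, x ∈ B ↔ ∀ y, (∀ z ∈ S, z * y = y * z) → y * x = x * y := by
    intro x
    simp only [B, Subalgebra.mem_centralizer_iff, SetLike.mem_coe]
  have hSB : ∀ x ∈ S, x ∈ B := fun x hx => (hB x).2 (fun y hy => (hy x hx).symm)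
  have hBS : ∀ x ∈ B, ∀ z ∈ S, z * x = x * z := fun x hx z hz =>
    (hB x).1 hx z (fun w hw => hS w hw z hz)
  let 𝒦 : GradedSubfield 𝒟 :=
    { comp := fun k => 𝒟 k ⊓ Subalgebra.toSubmodule B
      le := fun k => inf_le_left
      one_mem := ⟨hD.one_mem, B.one_mem⟩
      mul_mem := fun ha hb => ⟨hD.mul_mem ha.1 hb.1, B.mul_mem ha.2 hb.2⟩
      comm := fun {g h a b} ha hb => by
        exact (hB b).1 hb.2 a (fun z hz => hBS a ha.2 z hz)
      inv_mem := fun {g a} ha ha0 => by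
        obtain ⟨b, hb, hab, hba⟩ := hD.inv ha.1 ha0
        refine ⟨b, ⟨hb, ?_⟩, hab, hba⟩
        refine (hB b).2 (fun y hy => ?_)
        have h1 := (hB a).1 ha.2 y hy
        calc y * b = (b * a) * (y * b) := by rw [hba, one_mul]
          _ = b * (a * y) * b := by noncomm_ring
          _ = b * y * (a * b) := by rw [← h1]; noncomm_ring
          _ = b * y := by rw [hab, mul_one] }
  exact hmax 𝒦 (fun h => ⟨chom h, hSB _ (Or.inr ⟨h, rfl⟩)⟩) g f ⟨hf, hSB _ (Or.inl rfl)⟩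

set_option linter.unusedSectionVars false

section GDAlemmas
variable {F : Type*} [Field F] {G : Type*} [AddCommGroup G] {A : Type*} [Ring A]
    [Algebra F A] [Nontrivial A] {𝒟 : G → Submodule F A}

lemma GDA.mul_ne_zero (hD : GDA 𝒟) {s : G} {x y : A} (hx : x ∈ 𝒟 s)
    (hx0 : x ≠ 0) (hy0 : y ≠ 0) : x * y ≠ 0 := by
  obtain ⟨b, -, -, hb⟩ := hD.inv hx hx0
  intro h
  apply hy0
  rw [← one_mul y, ← hb, mul_assoc, h, mul_zero]

/-- the support as a subgroup -/
def GDA.supp (hD : GDA 𝒟) : AddSubgroup G where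
  carrier := {g | 𝒟 g ≠ ⊥}
  zero_mem' := by
    intro h
    have := hD.one_mem
    rw [h, Submodule.mem_bot] at this
    exact one_ne_zero this
  add_mem' := by
    intro a b ha hb
    obtain ⟨x, hx, hx0⟩ := Submodule.exists_mem_ne_zero_of_ne_bot ha
    obtain ⟨y, hy, hy0⟩ := Submodule.exists_mem_ne_zero_of_ne_bot hb
    exact Submodule.ne_bot_iff _ |>.2 ⟨x * y, hD.mul_mem hx hy, hD.mul_ne_zero hx hx0 hy0⟩
  neg_mem' := by
    intro a ha
    obtain ⟨x, hx, hx0⟩ := Submodule.exists_mem_ne_zero_of_ne_bot ha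
    obtain ⟨y, hy, hxy, -⟩ := hD.inv hx hx0
    refine Submodule.ne_bot_iff _ |>.2 ⟨y, hy, ?_⟩
    rintro rfl
    simp at hxy

lemma GDA.mem_supp (hD : GDA 𝒟) {g : G} : g ∈ hD.supp ↔ ∃ x ∈ 𝒟 g, x ≠ 0 :=
  Submodule.ne_bot_iff _

end GDAlemmas

section Main
variable {F : Type*} [Field F] [IsAlgClosed F] {G : Type*} [AddCommGroup G] {A : Type*} [Ring A]
    [Algebra F A] [Nontrivial A] {𝒟 : G → Submodule F A} {H : AddSubgroup G} {c : ↥H → A}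

lemma Setup.c_inv (S : Setup 𝒟 H c) (h : H) : c h * c (-h) = 1 := by
  rw [← S.cmul, add_neg_cancel, S.c0]

lemma Setup.c_inv' (S : Setup 𝒟 H c) (h : H) : c (-h) * c h = 1 := by
  rw [← S.cmul, neg_add_cancel, S.c0]

lemma Setup.c_ne (S : Setup 𝒟 H c) (h : H) : c h ≠ 0 := by
  intro h0
  have := S.c_inv h
  rw [h0, zero_mul] at this
  exact zero_ne_one this

lemma Setup.deg_zero (S : Setup 𝒟 H c) {x : A} (hx : x ∈ 𝒟 0) :
    ∃ a : F, x = a • (1 : A) := by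
  have := S.fin
  have := Fintype.ofFinite H
  have := finite_chars S.card
  have := Fintype.ofFinite (Multiplicative H →* Fˣ)
  let ρ : H → A →ₗ[F] A := fun h => LinearMap.mulLeft F (c h) ∘ₗ LinearMap.mulRight F (c (-h))
  have hρ : ∀ h y, ρ h y = c h * (y * c (-h)) := fun h y => rfl
  suffices hs : x ∈ Submodule.span F {(1 : A)} by
    obtain ⟨a, ha⟩ := Submodule.mem_span_singleton.1 hs
    exact ⟨a, ha.symm⟩
  rw [← eproj_sum S.card (fun h => ρ h) (by intro v; simp [hρ, S.c0]) x]
  refine Submodule.sum_mem _ (fun χ _ => ?_)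
  have heig := eproj_eigen ρ (by
    intro a b v
    rw [hρ, hρ, hρ, S.cmul, neg_add_rev, S.cmul]; noncomm_ring) χ x
  set y := eproj (fun h => ρ h) χ x with hy
  have hy0 : y ∈ 𝒟 0 := by
    refine Submodule.smul_mem _ _ (Submodule.sum_mem _ (fun h _ => Submodule.smul_mem _ _ ?_))
    have := S.gda.mul_mem (S.chom h) (S.gda.mul_mem hx (S.chom (-h)))
    rw [← hρ] at this
    simpa only [AddSubgroup.coe_neg, zero_add, add_neg_cancel] using this
  have hcy : ∀ h, c h * y = ((χ (Multiplicative.ofAdd h) : Fˣ) : F) • (y * c h) := by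
    intro h
    have := congrArg (· * c h) (heig h)
    simp only [hρ, smul_mul_assoc] at this
    rw [← this, mul_assoc, mul_assoc, S.c_inv', mul_one]
  have hpow : ∀ (n : ℕ) h, c h * y ^ n
      = (((χ (Multiplicative.ofAdd h) : Fˣ) : F) ^ n) • (y ^ n * c h) := by
    intro n h
    induction n with
    | zero => simp
    | succ n ih =>
      rw [pow_succ, ← mul_assoc, ih, smul_mul_assoc, mul_assoc, hcy, mul_smul_comm, smul_smul,
        pow_succ]
      noncomm_ring
  have hpow0 : ∀ n : ℕ, y ^ n ∈ 𝒟 0 := by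
    intro n
    induction n with
    | zero => simpa using S.gda.one_mem
    | succ n ih =>
      have := S.gda.mul_mem ih hy0
      rwa [add_zero, ← pow_succ] at this
  obtain ⟨h, a, hh, ha⟩ := S.centr 0 (y ^ Nat.card H) (hpow0 _) (by
    intro h
    rw [hpow, ← Units.val_pow_eq_pow_val, ← map_pow, ← ofAdd_nsmul, card_nsmul_eq_zero']
    simp)
  have hh0 : h = 0 := by ext; simpa using hh
  rw [hh0, S.c0] at ha
  have hcard : Nat.card H ≠ 0 := fun h => S.card (by rw [h, Nat.cast_zero])
  let p : Polynomial F := Polynomial.X ^ Nat.card H - Polynomial.C a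
  have hpm : p.Monic := Polynomial.monic_X_pow_sub_C a hcard
  have hp : Polynomial.aeval y p = 0 := by
    rw [map_sub, map_pow, Polynomial.aeval_X, Polynomial.aeval_C, ha,
      Algebra.algebraMap_eq_smul_one, sub_self]
  have heq : p = (p.roots.map (fun a => Polynomial.X - Polynomial.C a)).prod :=
    (IsAlgClosed.splits p).eq_prod_roots_of_monic hpm
  obtain ⟨k, hk, -⟩ := spectrum.exists_mem_of_not_isUnit_aeval_prod (p := p) (a := y) (by
    rw [← heq, hp]; exact not_isUnit_zero)
  have hk0 : algebraMap F A k - y = 0 := by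
    by_contra hne
    apply hk
    rw [spectrum.mem_resolventSet_iff]
    rw [Algebra.algebraMap_eq_smul_one] at hne ⊢
    obtain ⟨b, -, hb, hb'⟩ := S.gda.inv (Submodule.sub_mem _ (Submodule.smul_mem _ k S.gda.one_mem)
      hy0) hne
    exact ⟨⟨_, b, hb, hb'⟩, rfl⟩
  rw [Submodule.mem_span_singleton]
  exact ⟨k, by rw [← Algebra.algebraMap_eq_smul_one, sub_eq_zero.1 hk0]⟩

lemma Setup.line (S : Setup 𝒟 H c) {t : G} {x y : A} (hx : x ∈ 𝒟 t) (hy : y ∈ 𝒟 t)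
    (hx0 : x ≠ 0) : ∃ a : F, y = a • x := by
  obtain ⟨b, hb, hxb, hbx⟩ := S.gda.inv hx hx0
  have := S.gda.mul_mem hb hy
  rw [neg_add_cancel] at this
  obtain ⟨a, ha⟩ := S.deg_zero this
  refine ⟨a, ?_⟩
  rw [← one_mul y, ← hxb, mul_assoc, ha, mul_smul_comm, mul_one]

lemma Setup.exists_beta (S : Setup 𝒟 H c) (s t : S.gda.supp) :
    ∃ b : Fˣ, ∀ x ∈ 𝒟 (s : G), ∀ y ∈ 𝒟 (t : G), x * y = (b : F) • (y * x) := by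
  obtain ⟨x, hx, hx0⟩ := S.gda.mem_supp.1 s.2
  obtain ⟨y, hy, hy0⟩ := S.gda.mem_supp.1 t.2
  have h1 := S.gda.mul_mem hx hy
  have h2 := S.gda.mul_mem hy hx
  rw [add_comm] at h2
  obtain ⟨b, hb⟩ := S.line h2 h1 (S.gda.mul_ne_zero hy hy0 hx0)
  have hb0 : b ≠ 0 := by
    rintro rfl
    rw [zero_smul] at hb
    exact S.gda.mul_ne_zero hx hx0 hy0 hb
  refine ⟨Units.mk0 b hb0, fun x' hx' y' hy' => ?_⟩
  obtain ⟨p, rfl⟩ := S.line hx hx' hx0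
  obtain ⟨q, rfl⟩ := S.line hy hy' hy0
  simp only [Units.val_mk0, smul_mul_assoc, mul_smul_comm, hb]
  simp only [smul_smul]
  congr 1; ring

/-- commutation factor -/
def Setup.beta (S : Setup 𝒟 H c) (s t : S.gda.supp) : Fˣ := (S.exists_beta s t).choose

lemma Setup.beta_spec (S : Setup 𝒟 H c) (s t : S.gda.supp) {x y : A} (hx : x ∈ 𝒟 (s : G))
    (hy : y ∈ 𝒟 (t : G)) : x * y = (S.beta s t : F) • (y * x) :=
  (S.exists_beta s t).choose_spec x hx y hy

lemma Setup.beta_unique (S : Setup 𝒟 H c) (s t : S.gda.supp) {x y : A} (hx : x ∈ 𝒟 (s : G))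
    (hy : y ∈ 𝒟 (t : G)) (hx0 : x ≠ 0) (hy0 : y ≠ 0) (b : Fˣ) (h : x * y = (b : F) • (y * x)) :
    S.beta s t = b := by
  rw [S.beta_spec s t hx hy] at h
  exact Units.ext (smul_left_injective F (S.gda.mul_ne_zero hy hy0 hx0) h)

lemma Setup.beta_add_left (S : Setup 𝒟 H c) (s s' t : S.gda.supp) :
    S.beta (s + s') t = S.beta s t * S.beta s' t := by
  obtain ⟨x, hx, hx0⟩ := S.gda.mem_supp.1 s.2
  obtain ⟨x', hx', hx0'⟩ := S.gda.mem_supp.1 s'.2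
  obtain ⟨y, hy, hy0⟩ := S.gda.mem_supp.1 t.2
  refine S.beta_unique (s + s') t (S.gda.mul_mem hx hx') hy (S.gda.mul_ne_zero hx hx0 hx0') hy0 _ ?_
  rw [mul_assoc, S.beta_spec s' t hx' hy, mul_smul_comm, ← mul_assoc, S.beta_spec s t hx hy,
    smul_mul_assoc, smul_smul, Units.val_mul, mul_assoc, mul_comm (S.beta s t : F)]

lemma Setup.beta_add_right (S : Setup 𝒟 H c) (s t t' : S.gda.supp) :
    S.beta s (t + t') = S.beta s t * S.beta s t' := by
  obtain ⟨x, hx, hx0⟩ := S.gda.mem_supp.1 s.2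
  obtain ⟨y', hy', hy0'⟩ := S.gda.mem_supp.1 t'.2
  obtain ⟨y, hy, hy0⟩ := S.gda.mem_supp.1 t.2
  refine S.beta_unique s (t + t') hx (S.gda.mul_mem hy hy') hx0 (S.gda.mul_ne_zero hy hy0 hy0') _ ?_
  rw [← mul_assoc, S.beta_spec s t hx hy, smul_mul_assoc, mul_assoc, S.beta_spec s t' hx hy',
    mul_smul_comm, smul_smul, Units.val_mul, mul_assoc]

lemma Setup.H_le (S : Setup 𝒟 H c) : H ≤ S.gda.supp := fun h hh =>
  S.gda.mem_supp.2 ⟨c ⟨h, hh⟩, S.chom ⟨h, hh⟩, S.c_ne _⟩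

/-- The pairing. -/
def Setup.pairing (S : Setup 𝒟 H c) : S.gda.supp →+ H →+ Additive Fˣ :=
  AddMonoidHom.mk' (fun t => AddMonoidHom.mk'
    (fun h => Additive.ofMul (S.beta t ⟨h, S.H_le h.2⟩))
    (fun h h' => by
      rw [← ofMul_mul, ← S.beta_add_right]; rfl))
    (fun s s' => by
      ext h
      simp [S.beta_add_left])

lemma Setup.pairing_eq_zero (S : Setup 𝒟 H c) {t : S.gda.supp} {h : H} {x : A}
    (hx : x ∈ 𝒟 (t : G)) (hx0 : x ≠ 0) :
    S.pairing t h = 0 ↔ c h * x = x * c h := by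
  have e : S.pairing t h = Additive.ofMul (S.beta t ⟨h, S.H_le h.2⟩) := rfl
  rw [e, ofMul_eq_zero]
  constructor
  · intro hb
    have := S.beta_spec t ⟨h, S.H_le h.2⟩ hx (S.chom h)
    rw [hb, Units.val_one, one_smul] at this
    exact this.symm
  · intro hb
    refine S.beta_unique t ⟨h, S.H_le h.2⟩ hx (S.chom h) hx0 (S.c_ne h) 1 ?_
    rw [Units.val_one, one_smul, hb]

lemma Setup.pairing_ker (S : Setup 𝒟 H c) : S.pairing.ker = H.addSubgroupOf S.gda.supp := by
  ext t
  obtain ⟨x, hx, hx0⟩ := S.gda.mem_supp.1 t.2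
  rw [AddMonoidHom.mem_ker, AddSubgroup.mem_addSubgroupOf]
  constructor
  · intro ht
    obtain ⟨h, -, hh, -⟩ := S.centr t x hx (fun h => (S.pairing_eq_zero hx hx0).1 (by rw [ht]; rfl))
    rw [← hh]; exact h.2
  · intro ht
    ext1 h
    rw [AddMonoidHom.zero_apply]
    refine (S.pairing_eq_zero (t := t) (S.chom ⟨t, ht⟩) (S.c_ne _)).2 ?_
    rw [← S.cmul, ← S.cmul, add_comm]

/-- Data of the support of the centre. -/
def CenterSupp (𝒟 : G → Submodule F A) (Z : AddSubgroup G) : Prop :=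
  (Z : Set G) = {g : G | ∃ f : A, f ≠ 0 ∧ f ∈ 𝒟 g ∧ ∀ f' : A, f * f' = f' * f}

lemma Setup.Z_le (S : Setup 𝒟 H c) {Z : AddSubgroup G} (hZ : CenterSupp 𝒟 Z) : Z ≤ H := by
  intro z hz
  have hz' : z ∈ (Z : Set G) := hz
  rw [hZ] at hz'
  obtain ⟨f, hf0, hf, hfc⟩ := hz'
  obtain ⟨h, -, hh, -⟩ := S.centr z f hf (fun h => (hfc _).symm)
  rw [← hh]; exact h.2

lemma Setup.c_central (S : Setup 𝒟 H c) {Z : AddSubgroup G} (hZ : CenterSupp 𝒟 Z) (h : H)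
    (hz : (h : G) ∈ Z) (f : A) : c h * f = f * c h := by
  have hz' : (h : G) ∈ (Z : Set G) := hz
  rw [hZ] at hz'
  obtain ⟨x, hx0, hx, hxc⟩ := hz'
  obtain ⟨a, ha⟩ := S.line hx (S.chom h) hx0
  rw [ha, smul_mul_assoc, hxc, mul_smul_comm]

lemma Setup.pairing_flip_ker (S : Setup 𝒟 H c) {Z : AddSubgroup G} (hZ : CenterSupp 𝒟 Z) :
    S.pairing.flip.ker = Z.addSubgroupOf H := by
  ext h
  rw [AddMonoidHom.mem_ker, AddSubgroup.mem_addSubgroupOf]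
  constructor
  · intro hh
    have hz : (h : G) ∈ (Z : Set G) := by
      rw [hZ]
      refine ⟨c h, S.c_ne h, S.chom h, fun f' => ?_⟩
      refine S.gda.decomp.induct (p := fun f' => c h * f' = f' * c h) ?_ ?_ ?_ f'
      · simp
      · intro x y hx hy
        rw [mul_add, hx, hy, add_mul]
      · intro t x hx
        by_cases hx0 : x = 0
        · simp [hx0]
        · refine (S.pairing_eq_zero (t := ⟨t, S.gda.mem_supp.2 ⟨x, hx, hx0⟩⟩) hx hx0).1 ?_
          rw [← AddMonoidHom.flip_apply, hh]; rfl
    exact hz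
  · intro hz
    ext1 t
    obtain ⟨x, hx, hx0⟩ := S.gda.mem_supp.1 t.2
    rw [AddMonoidHom.flip_apply, AddMonoidHom.zero_apply]
    exact (S.pairing_eq_zero hx hx0).2 (S.c_central hZ h hz x)

lemma Setup.index_eq (S : Setup 𝒟 H c) {Z : AddSubgroup G} (hZ : CenterSupp 𝒟 Z) :
    Finite S.gda.supp ∧ H.relIndex S.gda.supp = Z.relIndex H := by
  have := S.fin
  have h := pairing_index S.pairing inferInstance
  rw [S.pairing_ker, S.pairing_flip_ker hZ] at h
  refine ⟨?_, h.2⟩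
  have h1 := h.1
  have : Finite (H.addSubgroupOf S.gda.supp) :=
    Finite.of_injective (fun x => (⟨x.1.1, x.2⟩ : H)) (by
      intro x y hxy
      ext
      exact congrArg (fun z : H => (z : G)) hxy)
  exact Finite.of_equiv _ (AddSubgroup.addGroupEquivQuotientProdAddSubgroup
    (s := H.addSubgroupOf S.gda.supp)).symm

lemma Setup.relIndex_sq (S : Setup 𝒟 H c) {Z : AddSubgroup G} (hZ : CenterSupp 𝒟 Z) :
    Z.relIndex S.gda.supp = (Z.relIndex H) ^ 2 := by
  rw [← AddSubgroup.relIndex_mul_relIndex Z H S.gda.supp (S.Z_le hZ) S.H_le, (S.index_eq hZ).2, sq]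

lemma Setup.card_supp (S : Setup 𝒟 H c) {Z : AddSubgroup G} (hZ : CenterSupp 𝒟 Z) :
    (Nat.card S.gda.supp : F) ≠ 0 := by
  have h1 : Nat.card H * Z.relIndex H = Nat.card S.gda.supp := by
    rw [← (S.index_eq hZ).2, ← AddSubgroup.relIndex_bot_left, ← AddSubgroup.relIndex_bot_left,
      AddSubgroup.relIndex_mul_relIndex _ _ _ bot_le S.H_le]
  have h2 : Z.relIndex H ∣ Nat.card H := AddSubgroup.index_dvd_card _
  obtain ⟨m, hm⟩ := h2
  rw [← h1, Nat.cast_mul]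
  refine mul_ne_zero S.card ?_
  intro h0
  apply S.card
  rw [hm, Nat.cast_mul, h0, zero_mul]

end Main

set_option linter.unusedSectionVars false

/-- Primitive central idempotent. -/
structure PrimIdem {A : Type*} [Ring A] (ε : A) : Prop where
  central : ∀ f : A, ε * f = f * ε
  idem : ε * ε = ε
  ne : ε ≠ 0
  prim : ∀ e : A, (∀ f, e * f = f * e) → e * e = e → e * ε = e → e = 0 ∨ e = ε

/-- Abstract corner grading. -/
def cG {F : Type*} [Field F] {G : Type*} [AddCommGroup G] {A : Type*} [Ring A] [Algebra F A]
    (Z : AddSubgroup G) (𝒟 : G → Submodule F A) (ε : A) : G ⧸ Z → Submodule F A :=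
  fun q => ⨆ g : {g : G // (QuotientAddGroup.mk' Z) g = q},
    Submodule.map (LinearMap.mulRight F ε) (𝒟 (g : G))

section Main
variable {F : Type*} [Field F] [IsAlgClosed F] {G : Type*} [AddCommGroup G] {A : Type*} [Ring A]
    [Algebra F A] [Nontrivial A] {𝒟 : G → Submodule F A} {H : AddSubgroup G} {c : ↥H → A}
    {Z : AddSubgroup G}

/-- The basis of the centre. -/
def Setup.cz (S : Setup 𝒟 H c) (hZ : CenterSupp 𝒟 Z) (z : Z) : A := c ⟨z, S.Z_le hZ z.2⟩

lemma Setup.cz_mem (S : Setup 𝒟 H c) (hZ : CenterSupp 𝒟 Z) (z : Z) : S.cz hZ z ∈ 𝒟 (z : G) :=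
  S.chom ⟨z, S.Z_le hZ z.2⟩

lemma Setup.cz_ne (S : Setup 𝒟 H c) (hZ : CenterSupp 𝒟 Z) (z : Z) : S.cz hZ z ≠ 0 :=
  S.c_ne _

lemma Setup.cz_add (S : Setup 𝒟 H c) (hZ : CenterSupp 𝒟 Z) (z z' : Z) :
    S.cz hZ (z + z') = S.cz hZ z * S.cz hZ z' :=
  S.cmul ⟨z, S.Z_le hZ z.2⟩ ⟨z', S.Z_le hZ z'.2⟩

lemma Setup.cz_zero (S : Setup 𝒟 H c) (hZ : CenterSupp 𝒟 Z) : S.cz hZ 0 = 1 :=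
  S.c0

lemma Setup.cz_central (S : Setup 𝒟 H c) (hZ : CenterSupp 𝒟 Z) (z : Z) (f : A) :
    S.cz hZ z * f = f * S.cz hZ z :=
  S.c_central hZ _ z.2 f

lemma Setup.center_span (S : Setup 𝒟 H c) (hZ : CenterSupp 𝒟 Z) {x : A}
    (hx : ∀ f, x * f = f * x) : x ∈ Submodule.span F (Set.range (S.cz hZ)) := by
  obtain ⟨π, h1, h2, h3, h4⟩ := S.gda.decomp.exists_proj
  have hr : ∀ (g s : G) (y : A), y ∈ 𝒟 s → ∀ x, π (g + s) (x * y) = π g x * y := by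
    intro g s y hy x
    refine S.gda.decomp.induct (p := fun x => π (g + s) (x * y) = π g x * y) (by simp) ?_ ?_ x
    · intro a b ha hb
      rw [add_mul, map_add, ha, hb, map_add, add_mul]
    · intro k a ha
      have hm := S.gda.mul_mem ha hy
      by_cases hk : k = g
      · subst hk; rw [h1 _ _ hm, h1 _ _ ha]
      · rw [h2 _ _ (by simpa using hk) _ hm, h2 _ _ hk _ ha, zero_mul]
  have hl : ∀ (g s : G) (y : A), y ∈ 𝒟 s → ∀ x, π (g + s) (y * x) = y * π g x := by
    intro g s y hy x
    refine S.gda.decomp.induct (p := fun x => π (g + s) (y * x) = y * π g x) (by simp) ?_ ?_ x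
    · intro a b ha hb
      rw [mul_add, map_add, ha, hb, map_add, mul_add]
    · intro k a ha
      have hm := S.gda.mul_mem hy ha
      rw [add_comm] at hm
      by_cases hk : k = g
      · subst hk; rw [h1 _ _ hm, h1 _ _ ha]
      · rw [h2 _ _ (by simpa using hk) _ hm, h2 _ _ hk _ ha, mul_zero]
  have hc : ∀ g f, π g x * f = f * π g x := by
    intro g f
    refine S.gda.decomp.induct (p := fun f => π g x * f = f * π g x) (by simp) ?_ ?_ f
    · intro a b ha hb
      rw [mul_add, ha, hb, add_mul]
    · intro s y hy
      rw [← hr g s y hy, ← hl g s y hy, hx]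
  obtain ⟨t, -, ht⟩ := h4 x
  rw [ht]
  refine Submodule.sum_mem _ (fun g _ => ?_)
  by_cases h0 : π g x = 0
  · rw [h0]; exact zero_mem _
  · have hg : g ∈ (Z : Set G) := by
      rw [hZ]
      exact ⟨π g x, h0, h3 _ _, hc g⟩
    obtain ⟨a, ha⟩ := S.line (S.cz_mem hZ ⟨g, hg⟩) (h3 g x) (S.cz_ne hZ _)
    rw [ha]
    exact Submodule.smul_mem _ _ (Submodule.subset_span ⟨_, rfl⟩)

lemma Setup.exists_chi (S : Setup 𝒟 H c) (hZ : CenterSupp 𝒟 Z) {ε : A} (E : PrimIdem ε) :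
    ∃ χ : Z →+ Additive Fˣ, ∀ z, S.cz hZ z * ε = (((χ z).toMul : Fˣ) : F) • ε := by
  have := S.fin
  have : Finite Z := Finite.of_injective _ (AddSubgroup.inclusion_injective (S.Z_le hZ))
  have := Fintype.ofFinite Z
  have hcard : (Nat.card Z : F) ≠ 0 := by
    intro h0
    obtain ⟨m, hm⟩ := AddSubgroup.card_dvd_of_le (S.Z_le hZ)
    apply S.card
    rw [hm, Nat.cast_mul, h0, zero_mul]
  have := finite_chars hcard
  have := Fintype.ofFinite (Multiplicative Z →* Fˣ)
  let ρ : Z → A →ₗ[F] A := fun z => LinearMap.mulLeft F (S.cz hZ z)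
  have hρ : ∀ h y, ρ h y = S.cz hZ h * y := fun h y => rfl
  have hsum := eproj_sum hcard (fun h => ρ h) (by intro v; simp [hρ, S.cz_zero]) ε
  obtain ⟨χ, hχ⟩ : ∃ χ : Multiplicative Z →* Fˣ, eproj (fun h => ρ h) χ ε ≠ 0 := by
    by_contra! hcon
    rw [Finset.sum_eq_zero (fun χ _ => hcon χ)] at hsum
    exact E.ne hsum.symm
  have heig := eproj_eigen ρ (by
    intro a b v
    rw [hρ, hρ, hρ, S.cz_add, mul_assoc]) χ ε
  set e := eproj (fun h => ρ h) χ ε with he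
  have he' : e = (Nat.card Z : F)⁻¹ • ∑ k : Z,
    ((χ (Multiplicative.ofAdd (-k)) : Fˣ) : F) • (S.cz hZ k * ε) := rfl
  have hec : ∀ f, e * f = f * e := by
    intro f
    rw [he', smul_mul_assoc, mul_smul_comm, Finset.sum_mul, Finset.mul_sum]
    congr 1
    refine Finset.sum_congr rfl (fun k _ => ?_)
    rw [smul_mul_assoc, mul_smul_comm, mul_assoc, E.central, ← mul_assoc, S.cz_central, mul_assoc]
  have heε : e * ε = e := by
    rw [he', smul_mul_assoc, Finset.sum_mul]
    congr 1
    refine Finset.sum_congr rfl (fun k _ => ?_)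
    rw [smul_mul_assoc, mul_assoc, E.idem]
  have hee : e * e = e := by
    have h1 : ∀ k : Z, ((χ (Multiplicative.ofAdd (-k)) : Fˣ) : F) • (S.cz hZ k * ε) * e = e := by
      intro k
      rw [smul_mul_assoc, mul_assoc, E.central, heε, ← hρ, heig, smul_smul, ← Units.val_mul,
        ← map_mul, ← ofAdd_add, neg_add_cancel, ofAdd_zero, map_one, Units.val_one, one_smul]
    conv_lhs => enter [1]; rw [he']
    rw [smul_mul_assoc, Finset.sum_mul, Finset.sum_congr rfl (fun k _ => h1 k), Finset.sum_const,
      Finset.card_univ, ← Nat.card_eq_fintype_card, ← Nat.cast_smul_eq_nsmul F, smul_smul,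
      inv_mul_cancel₀ hcard, one_smul]
  rcases E.prim e hec hee heε with h | h
  · exact absurd h hχ
  · refine ⟨MonoidHom.toAdditiveRight χ, fun z => ?_⟩
    have := heig z
    rw [h, hρ] at this
    exact this

lemma mul_mem_cG (ε : A) {g : G} {d : A} (hd : d ∈ 𝒟 g) :
    d * ε ∈ cG Z 𝒟 ε (QuotientAddGroup.mk' Z g) :=
  Submodule.mem_iSup_of_mem (⟨g, rfl⟩ : {g' : G // (QuotientAddGroup.mk' Z) g' = QuotientAddGroup.mk' Z g})
    ⟨d, hd, rfl⟩

lemma Setup.mem_cG (S : Setup 𝒟 H c) (hZ : CenterSupp 𝒟 Z) {ε : A} (E : PrimIdem ε) {g : G}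
    {x : A} (hx : x ∈ cG Z 𝒟 ε (QuotientAddGroup.mk' Z g)) : ∃ d ∈ 𝒟 g, x = d * ε := by
  obtain ⟨χ, hχ⟩ := S.exists_chi hZ E
  have hle : cG Z 𝒟 ε (QuotientAddGroup.mk' Z g) ≤ Submodule.map (LinearMap.mulRight F ε) (𝒟 g) := by
    refine iSup_le ?_
    rintro ⟨g', hg'⟩ _ ⟨d, hd, rfl⟩
    have hz : -g' + g ∈ Z := by
      rw [← QuotientAddGroup.eq]; exact hg'
    have hm := S.gda.mul_mem hd (S.cz_mem hZ ⟨_, hz⟩)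
    simp only [add_neg_cancel_left] at hm
    refine ⟨(((χ ⟨_, hz⟩).toMul⁻¹ : Fˣ) : F) • (d * S.cz hZ ⟨_, hz⟩), Submodule.smul_mem _ _ hm, ?_⟩
    rw [LinearMap.mulRight_apply, LinearMap.mulRight_apply, smul_mul_assoc, mul_assoc, hχ,
      mul_smul_comm, smul_smul, ← Units.val_mul, inv_mul_cancel, Units.val_one, one_smul]
  obtain ⟨d, hd, rfl⟩ := hle hx
  exact ⟨d, hd, rfl⟩

lemma Setup.mem_cG' (S : Setup 𝒟 H c) (hZ : CenterSupp 𝒟 Z) {ε : A} (E : PrimIdem ε) {q : G ⧸ Z}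
    {x : A} (hx : x ∈ cG Z 𝒟 ε q) : ∃ g, QuotientAddGroup.mk' Z g = q ∧ ∃ d ∈ 𝒟 g, x = d * ε := by
  obtain ⟨g, rfl⟩ := QuotientAddGroup.mk'_surjective Z q
  exact ⟨g, rfl, S.mem_cG hZ E hx⟩

lemma Setup.cG_inv (S : Setup 𝒟 H c) (hZ : CenterSupp 𝒟 Z) {ε : A} (E : PrimIdem ε) (q : G ⧸ Z)
    (x : A) (hx : x ∈ cG Z 𝒟 ε q) (hx0 : x ≠ 0) :
    ∃ y ∈ cG Z 𝒟 ε (-q), x * y = ε ∧ y * x = ε := by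
  obtain ⟨g, rfl, d, hd, rfl⟩ := S.mem_cG' hZ E hx
  have hd0 : d ≠ 0 := by rintro rfl; simp at hx0
  obtain ⟨b, hb, h1, h2⟩ := S.gda.inv hd hd0
  refine ⟨b * ε, ?_, ?_, ?_⟩
  · rw [← map_neg]
    exact mul_mem_cG ε hb
  · rw [mul_assoc, ← mul_assoc ε, E.central b, mul_assoc b, E.idem, ← mul_assoc, h1, one_mul]
  · rw [mul_assoc, ← mul_assoc ε, E.central d, mul_assoc d, E.idem, ← mul_assoc, h2, one_mul]

lemma mem_corner {ε x : A} (E : PrimIdem ε) :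
    x ∈ cornerSubmodule (F := F) ε ↔ x * ε = x := by
  constructor
  · exact fun h => h.1
  · exact fun h => ⟨h, by rw [E.central, h]⟩

lemma Setup.cG_le (S : Setup 𝒟 H c) (hZ : CenterSupp 𝒟 Z) {ε : A} (E : PrimIdem ε) (q : G ⧸ Z) :
    cG Z 𝒟 ε q ≤ cornerSubmodule ε := by
  intro x hx
  obtain ⟨g, rfl, d, hd, rfl⟩ := S.mem_cG' hZ E hx
  rw [mem_corner E, mul_assoc, E.idem]

lemma Setup.cG_span (S : Setup 𝒟 H c) {ε : A} (E : PrimIdem ε) (x : A)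
    (hx : x ∈ cornerSubmodule (F := F) ε) :
    ∃ (t : Finset (G ⧸ Z)) (cc : (G ⧸ Z) → A), (∀ q ∈ t, cc q ∈ cG Z 𝒟 ε q) ∧
      x = ∑ q ∈ t, cc q := by
  classical
  rw [mem_corner E] at hx
  obtain ⟨t, d, hd, hxd⟩ := S.gda.decomp.1 x
  refine ⟨t.image (QuotientAddGroup.mk' Z),
    fun q => ∑ g ∈ t with QuotientAddGroup.mk' Z g = q, d g * ε, ?_, ?_⟩
  · intro q _
    refine Submodule.sum_mem _ (fun g hg => ?_)
    rw [Finset.mem_filter] at hg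
    obtain ⟨hg, rfl⟩ := hg
    exact mul_mem_cG ε (hd g hg)
  · rw [Finset.sum_fiberwise_of_maps_to (fun g hg => Finset.mem_image_of_mem _ hg)]
    rw [← Finset.sum_mul, ← hxd, hx]

lemma Setup.cG_indep (S : Setup 𝒟 H c) (hZ : CenterSupp 𝒟 Z) {ε : A} (E : PrimIdem ε)
    (t : Finset (G ⧸ Z)) (cc : (G ⧸ Z) → A)
    (hcc : ∀ q ∈ t, cc q ∈ cG Z 𝒟 ε q) (hsum : ∑ q ∈ t, cc q = 0) : ∀ q ∈ t, cc q = 0 := by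
  classical
  have H : ∀ q : G ⧸ Z, ∃ Φ : A →ₗ[F] A, ∀ g, ∀ v ∈ 𝒟 g,
      Φ v = (if QuotientAddGroup.mk' Z g = q then LinearMap.id else 0 : A →ₗ[F] A) v :=
    fun q => S.gda.decomp.glue
      (fun g => if QuotientAddGroup.mk' Z g = q then LinearMap.id else 0)
  choose Φ hΦ using H
  have key : ∀ q g d, d ∈ 𝒟 g → ∀ y ∈ Submodule.span F (Set.range (S.cz hZ)),
      Φ q (d * y) = if QuotientAddGroup.mk' Z g = q then d * y else 0 := by
    intro q g d hd y hy
    induction hy using Submodule.span_induction with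
    | mem x h =>
      obtain ⟨z, rfl⟩ := h
      rw [hΦ q _ _ (S.gda.mul_mem hd (S.cz_mem hZ z))]
      have : QuotientAddGroup.mk' Z (g + z) = QuotientAddGroup.mk' Z g :=
        QuotientAddGroup.mk_add_of_mem g z.2
      rw [this]
      split_ifs <;> rfl
    | zero => simp
    | add x y _ _ hx hy =>
      rw [mul_add, map_add, hx, hy]
      split_ifs <;> simp
    | smul a x _ hx =>
      rw [mul_smul_comm, map_smul, hx]
      split_ifs <;> simp
  have hε := S.center_span hZ E.central
  intro q hq
  have := congrArg (Φ q) hsum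
  rw [map_sum, map_zero, Finset.sum_eq_single q] at this
  · obtain ⟨g, rfl, d, hd, hx⟩ := S.mem_cG' hZ E (hcc q hq)
    rw [hx, key _ g d hd ε hε, if_pos rfl] at this
    rw [hx, this]
  · intro q' hq' hne
    obtain ⟨g, rfl, d, hd, hx⟩ := S.mem_cG' hZ E (hcc q' hq')
    rw [hx, key _ g d hd ε hε, if_neg hne]
  · exact fun h => absurd hq h

lemma Setup.cG_supp (S : Setup 𝒟 H c) (hZ : CenterSupp 𝒟 Z) {ε : A} (E : PrimIdem ε) :
    {q : G ⧸ Z | cG Z 𝒟 ε q ≠ ⊥} = ⇑(QuotientAddGroup.mk' Z) '' (S.gda.supp : Set G) := by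
  ext q
  constructor
  · intro hq
    obtain ⟨x, hx, hx0⟩ := Submodule.exists_mem_ne_zero_of_ne_bot hq
    obtain ⟨g, rfl, d, hd, rfl⟩ := S.mem_cG' hZ E hx
    refine ⟨g, S.gda.mem_supp.2 ⟨d, hd, ?_⟩, rfl⟩
    rintro rfl; simp at hx0
  · rintro ⟨g, hg, rfl⟩
    obtain ⟨d, hd, hd0⟩ := S.gda.mem_supp.1 hg
    exact (Submodule.ne_bot_iff _).2 ⟨d * ε, mul_mem_cG ε hd, S.gda.mul_ne_zero hd hd0 E.ne⟩

lemma Setup.span_scalar (S : Setup 𝒟 H c) (hZ : CenterSupp 𝒟 Z) {ε : A} (E : PrimIdem ε) {x : A}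
    (hx : x ∈ Submodule.span F (Set.range (S.cz hZ))) : ∃ a : F, x * ε = a • ε := by
  obtain ⟨χ, hχ⟩ := S.exists_chi hZ E
  induction hx using Submodule.span_induction with
  | mem x h =>
    obtain ⟨z, rfl⟩ := h
    exact ⟨_, hχ z⟩
  | zero => exact ⟨0, by simp⟩
  | add x y _ _ hx hy =>
    obtain ⟨a, ha⟩ := hx
    obtain ⟨b, hb⟩ := hy
    exact ⟨a + b, by rw [add_mul, ha, hb, add_smul]⟩
  | smul r x _ hx =>
    obtain ⟨a, ha⟩ := hx
    exact ⟨r * a, by rw [smul_mul_assoc, ha, smul_smul]⟩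

lemma Setup.corner_central (S : Setup 𝒟 H c) (hZ : CenterSupp 𝒟 Z) {ε : A} (E : PrimIdem ε) (x : A)
    (hx : x ∈ cornerSubmodule (F := F) ε)
    (hxc : ∀ y ∈ cornerSubmodule (F := F) ε, x * y = y * x) : ∃ a : F, x = a • ε := by
  have hc : ∀ f, x * f = f * x := by
    intro f
    have h1 : f * ε ∈ cornerSubmodule (F := F) ε := by
      rw [mem_corner E, mul_assoc, E.idem]
    have h2 := hxc _ h1
    rw [← E.central, ← mul_assoc, hx.1, E.central, mul_assoc, hx.2] at h2
    exact h2
  obtain ⟨a, ha⟩ := S.span_scalar hZ E (S.center_span hZ hc)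
  exact ⟨a, by rw [← ha, hx.1]⟩

lemma Setup.card_image (S : Setup 𝒟 H c) (K : AddSubgroup G) :
    Nat.card ↥(⇑(QuotientAddGroup.mk' Z) '' (K : Set G)) = Z.relIndex K := by
  have := AddSubgroup.relIndex_ker K (QuotientAddGroup.mk' Z)
  rw [QuotientAddGroup.ker_mk'] at this
  rw [this]; rfl

lemma Setup.finrank_corner (S : Setup 𝒟 H c) (hZ : CenterSupp 𝒟 Z) {ε : A} (E : PrimIdem ε) :
    Module.finrank F ↥(cornerSubmodule (F := F) ε)
        = Nat.card ↥(⇑(QuotientAddGroup.mk' Z) '' (S.gda.supp : Set G)) := by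
  have hfin := (S.index_eq hZ).1
  have : Finite ↥(⇑(QuotientAddGroup.mk' Z) '' (S.gda.supp : Set G)) :=
    Set.Finite.image _ (Set.toFinite _)
  have := Fintype.ofFinite ↥(⇑(QuotientAddGroup.mk' Z) '' (S.gda.supp : Set G))
  have hv : ∀ q : ↥(⇑(QuotientAddGroup.mk' Z) '' (S.gda.supp : Set G)),
      ∃ v ∈ cG Z 𝒟 ε (q : G ⧸ Z), v ≠ 0 := by
    rintro ⟨q, hq⟩
    rw [← S.cG_supp hZ E] at hq
    exact (Submodule.ne_bot_iff _).1 hq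
  choose v hv hv0 using hv
  have ind : iSupIndep (cG Z 𝒟 ε) :=
    (iSupIndep_iff_finsetSum_eq_zero_imp_eq_zero _).2 (S.cG_indep hZ E)
  have li : LinearIndependent F v :=
    (ind.comp Subtype.val_injective).linearIndependent _ hv hv0
  have hspan : cornerSubmodule (F := F) ε = Submodule.span F (Set.range v) := by
    apply le_antisymm
    · intro x hx
      obtain ⟨t, cc, hcc, rfl⟩ := S.cG_span (Z := Z) E x hx
      refine Submodule.sum_mem _ (fun q hq => ?_)
      by_cases h0 : cc q = 0
      · rw [h0]; exact zero_mem _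
      · have hq' : q ∈ ⇑(QuotientAddGroup.mk' Z) '' (S.gda.supp : Set G) := by
          rw [← S.cG_supp hZ E]
          exact (Submodule.ne_bot_iff _).2 ⟨_, hcc q hq, h0⟩
        obtain ⟨g, rfl⟩ := QuotientAddGroup.mk'_surjective Z q
        obtain ⟨d, hd, hx⟩ := S.mem_cG hZ E (hcc _ hq)
        obtain ⟨d', hd', hx'⟩ := S.mem_cG hZ E (hv ⟨_, hq'⟩)
        have hd0 : d' ≠ 0 := by
          rintro rfl
          exact hv0 ⟨_, hq'⟩ (by rw [hx', zero_mul])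
        obtain ⟨a, ha⟩ := S.line hd' hd hd0
        rw [hx, ha, smul_mul_assoc, ← hx']
        exact Submodule.smul_mem _ _ (Submodule.subset_span ⟨_, rfl⟩)
    · rw [Submodule.span_le]
      rintro _ ⟨q, rfl⟩
      exact S.cG_le hZ E _ (hv q)
  rw [hspan, finrank_span_eq_card li, Nat.card_eq_fintype_card]

lemma Setup.exists_Psi (S : Setup 𝒟 H c) (ψ : S.gda.supp →+ Additive Fˣ) :
    ∃ Ψ : A →ₗ[F] A, (∀ (g : S.gda.supp), ∀ x ∈ 𝒟 (g : G), Ψ x = (((ψ g).toMul : Fˣ) : F) • x) ∧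
      (∀ x y, Ψ (x * y) = Ψ x * Ψ y) := by
  classical
  obtain ⟨Ψ, hΨ⟩ := S.gda.decomp.glue (N := A) (fun g => if h : g ∈ S.gda.supp then
    (((ψ ⟨g, h⟩).toMul : Fˣ) : F) • LinearMap.id else 0)
  have h1 : ∀ (g : S.gda.supp), ∀ x ∈ 𝒟 (g : G), Ψ x = (((ψ g).toMul : Fˣ) : F) • x := by
    intro g x hx
    rw [hΨ _ _ hx, dif_pos g.2]
    rfl
  refine ⟨Ψ, h1, fun x y => ?_⟩
  refine S.gda.decomp.induct (p := fun x => Ψ (x * y) = Ψ x * Ψ y) (by simp) ?_ ?_ x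
  · intro a b ha hb
    rw [add_mul, map_add, ha, hb, map_add, add_mul]
  · intro g x hx
    refine S.gda.decomp.induct (p := fun y => Ψ (x * y) = Ψ x * Ψ y) (by simp) ?_ ?_ y
    · intro a b ha hb
      rw [mul_add, map_add, ha, hb, map_add, mul_add]
    · intro k y hy
      by_cases hx0 : x = 0
      · simp [hx0]
      by_cases hy0 : y = 0
      · simp [hy0]
      let g' : S.gda.supp := ⟨g, S.gda.mem_supp.2 ⟨x, hx, hx0⟩⟩
      let k' : S.gda.supp := ⟨k, S.gda.mem_supp.2 ⟨y, hy, hy0⟩⟩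
      rw [h1 g' x hx, h1 k' y hy, h1 (g' + k') _ (S.gda.mul_mem hx hy), map_add, toMul_add,
        Units.val_mul, smul_mul_smul_comm]

lemma Setup.Psi_inv (S : Setup 𝒟 H c) {ψ ψ' : S.gda.supp →+ Additive Fˣ} (hψ : ψ' + ψ = 0)
    {Ψ Ψ' : A →ₗ[F] A}
    (h : ∀ (g : S.gda.supp), ∀ x ∈ 𝒟 (g : G), Ψ x = (((ψ g).toMul : Fˣ) : F) • x)
    (h' : ∀ (g : S.gda.supp), ∀ x ∈ 𝒟 (g : G), Ψ' x = (((ψ' g).toMul : Fˣ) : F) • x) (x : A) :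
    Ψ' (Ψ x) = x := by
  refine S.gda.decomp.induct (p := fun x => Ψ' (Ψ x) = x) (by simp) ?_ ?_ x
  · intro a b ha hb
    rw [map_add, map_add, ha, hb]
  · intro g x hx
    by_cases hx0 : x = 0
    · simp [hx0]
    let g' : S.gda.supp := ⟨g, S.gda.mem_supp.2 ⟨x, hx, hx0⟩⟩
    have e : ψ' g' + ψ g' = 0 := by rw [← AddMonoidHom.add_apply, hψ]; rfl
    have e' : (((ψ g').toMul : Fˣ) : F) * (((ψ' g').toMul : Fˣ) : F) = 1 := by
      rw [← Units.val_mul, ← toMul_add, add_comm, e]; rfl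
    rw [h g' x hx, map_smul, h' g' x hx, smul_smul, e', one_smul]

lemma Setup.Psi_eps (S : Setup 𝒟 H c) (hZ : CenterSupp 𝒟 Z) {ε ε' : A} (E : PrimIdem ε)
    {χ χ' : Z →+ Additive Fˣ}
    (hχ : ∀ z, S.cz hZ z * ε = (((χ z).toMul : Fˣ) : F) • ε)
    (hχ' : ∀ z, S.cz hZ z * ε' = (((χ' z).toMul : Fˣ) : F) • ε')
    {ψ : S.gda.supp →+ Additive Fˣ} {Ψ : A →ₗ[F] A}
    (h : ∀ (g : S.gda.supp), ∀ x ∈ 𝒟 (g : G), Ψ x = (((ψ g).toMul : Fˣ) : F) • x)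
    (hψ : ∀ (z : Z) (hz : (z : G) ∈ S.gda.supp), ψ ⟨z, hz⟩ + χ' z = χ z) :
    Ψ ε * ε' = ε' := by
  have key : ∀ y ∈ Submodule.span F (Set.range (S.cz hZ)),
      ∃ s : F, y * ε = s • ε ∧ Ψ y * ε' = s • ε' := by
    intro y hy
    induction hy using Submodule.span_induction with
    | mem x hx =>
      obtain ⟨z, rfl⟩ := hx
      have hz : (z : G) ∈ S.gda.supp := S.H_le (S.Z_le hZ z.2)
      refine ⟨_, hχ z, ?_⟩
      rw [h ⟨z, hz⟩ _ (S.cz_mem hZ z), smul_mul_assoc, hχ', smul_smul, ← Units.val_mul, ← toMul_add,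
        hψ]
    | zero => exact ⟨0, by simp⟩
    | add x y _ _ hx hy =>
      obtain ⟨a, ha, ha'⟩ := hx
      obtain ⟨b, hb, hb'⟩ := hy
      exact ⟨a + b, by rw [add_mul, ha, hb, add_smul], by rw [map_add, add_mul, ha', hb', add_smul]⟩
    | smul r x _ hx =>
      obtain ⟨a, ha, ha'⟩ := hx
      exact ⟨r * a, by rw [smul_mul_assoc, ha, smul_smul],
        by rw [map_smul, smul_mul_assoc, ha', smul_smul]⟩
  obtain ⟨s, hs, hs'⟩ := key ε (S.center_span hZ E.central)
  have hs1 : s = 1 := by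
    rw [E.idem] at hs
    refine smul_left_injective F E.ne ?_
    simp only [one_smul]
    exact hs.symm
  rw [hs', hs1, one_smul]

lemma Setup.iso (S : Setup 𝒟 H c) (hZ : CenterSupp 𝒟 Z) {ε ε' : A} (E : PrimIdem ε)
    (E' : PrimIdem ε') : ∃ e : A →ₗ[F] A,
      Set.BijOn ⇑e ↑(cornerSubmodule (F := F) ε) ↑(cornerSubmodule (F := F) ε') ∧
      e ε = ε' ∧
      (∀ x ∈ cornerSubmodule (F := F) ε, ∀ y ∈ cornerSubmodule (F := F) ε,
        e (x * y) = e x * e y) ∧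
      (∀ q : G ⧸ Z, ∀ x ∈ cG Z 𝒟 ε q, e x ∈ cG Z 𝒟 ε' q) := by
  obtain ⟨χ, hχ⟩ := S.exists_chi hZ E
  obtain ⟨χ', hχ'⟩ := S.exists_chi hZ E'
  have hZT : Z ≤ S.gda.supp := (S.Z_le hZ).trans S.H_le
  have := (S.index_eq hZ).1
  obtain ⟨ψ, hψ⟩ := extend_char (S.card_supp hZ) (Z.addSubgroupOf S.gda.supp)
    ((χ - χ').comp (AddSubgroup.addSubgroupOfEquivOfLe hZT).toAddMonoidHom)
  have hψ1 : ∀ (z : Z) (hz : (z : G) ∈ S.gda.supp), ψ ⟨z, hz⟩ = χ z - χ' z := by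
    intro z hz
    exact hψ ⟨⟨z, hz⟩, z.2⟩
  obtain ⟨Ψ, h1, h2⟩ := S.exists_Psi ψ
  obtain ⟨Ψ', h1', h2'⟩ := S.exists_Psi (-ψ)
  have hinv := S.Psi_inv (neg_add_cancel ψ) h1 h1'
  have hinv' := S.Psi_inv (add_neg_cancel ψ) h1' h1
  have he : Ψ ε * ε' = ε' := S.Psi_eps hZ E hχ hχ' h1 (fun z hz => by
    rw [hψ1, sub_add_cancel])
  have he' : Ψ' ε' * ε = ε := S.Psi_eps hZ E' hχ' hχ h1' (fun z hz => by
    rw [AddMonoidHom.neg_apply, hψ1, neg_sub, sub_add_cancel])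
  have hmaps : ∀ {δ : A} (_ : PrimIdem δ) (x : A), x * δ ∈ cornerSubmodule (F := F) δ := by
    intro δ hδ x
    rw [mem_corner hδ, mul_assoc, hδ.idem]
  refine ⟨LinearMap.mulRight F ε' ∘ₗ Ψ, ?_, he, ?_, ?_⟩
  · have hI : Set.InvOn (LinearMap.mulRight F ε ∘ₗ Ψ') (LinearMap.mulRight F ε' ∘ₗ Ψ)
        ↑(cornerSubmodule (F := F) ε) ↑(cornerSubmodule (F := F) ε') := by
      constructor
      · intro x hx
        change Ψ' (Ψ x * ε') * ε = x
        rw [h2', hinv, mul_assoc, he', hx.1]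
      · intro x hx
        change Ψ (Ψ' x * ε) * ε' = x
        rw [h2, hinv', mul_assoc, he, hx.1]
    refine hI.bijOn ?_ ?_
    · intro x _
      exact hmaps E' _
    · intro x _
      exact hmaps E _
  · intro x _ y _
    change Ψ (x * y) * ε' = Ψ x * ε' * (Ψ y * ε')
    rw [h2, mul_assoc (Ψ x) ε', ← mul_assoc ε', E'.central (Ψ y), mul_assoc (Ψ y), E'.idem,
      mul_assoc]
  · intro q x hx
    obtain ⟨g, rfl, d, hd, rfl⟩ := S.mem_cG' hZ E hx
    change Ψ (d * ε) * ε' ∈ _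
    rw [h2, mul_assoc, he]
    refine mul_mem_cG ε' ?_
    by_cases hd0 : d = 0
    · rw [hd0, map_zero]; exact zero_mem _
    · rw [h1 ⟨g, S.gda.mem_supp.2 ⟨d, hd, hd0⟩⟩ d hd]
      exact Submodule.smul_mem _ _ hd

end Main

/-- With `D = C(W)`, `𝒵 = Z(D)` with support `Z`, and
`ε_1, …, ε_m` the primitive idempotents of `𝒵`:  each `Dε_i` is a central
`G/Z`-graded division algebra with support `T/Z` (grading
`(Dε_i)_{gZ} = D_g ε_i`), `n_1 = ⋯ = n_m = |H/Z| = √|T/Z|`, and the `Dε_i` are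
pairwise isomorphic as `G/Z`-graded algebras. -/
theorem statement17 {F : Type*} [Field F] [IsAlgClosed F] {G : Type*} [AddCommGroup G]
    {R : Type*} [Ring R] [Algebra F R] (H : AddSubgroup G)
    {W : Type*} [AddCommGroup W] [Module F W] [Module R W] [IsScalarTower F R W]
    [SMulCommClass R F W]
    (𝒜 : AlgebraGrading F G R) (𝒲 : ModuleGrading 𝒜 (AddMonoidHom.id G) W)
    (hsimple : IsGradedSimpleModule R 𝒲.comp)
    (hHfin : (H : Set G).Finite) (hchar : ¬ (ringChar F ∣ Nat.card ↥H))
    -- 𝓕 : a maximal graded subfield of C(W) isomorphic to FH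
    (c : ↥H → Module.End R W) (hc0 : c 0 = 1)
    (hchom : ∀ h : ↥H, IsHomogeneousEnd 𝒲.comp ((h : G)) (c h))
    (hcmul : ∀ h₁ h₂ : ↥H, c (h₁ + h₂) = c h₁ * c h₂)
    (hmax : ∀ 𝒦 : GradedSubfield (homogComp (R := R) 𝒲.comp),
      (∀ h : ↥H, c h ∈ 𝒦.comp ((h : G))) →
      ∀ (g : G) (f : Module.End R W), f ∈ 𝒦.comp g →
        ∃ (h : ↥H) (a : F), (h : G) = g ∧ f = a • c h)
    -- T : the support of D = C(W); Z : the support of the center of D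
    (T : Set G) (hT : T = {g : G | homogComp (R := R) 𝒲.comp g ≠ ⊥})
    (Z : AddSubgroup G)
    (hZ : (Z : Set G) = {g : G | ∃ f : Module.End R W, f ≠ 0 ∧
      f ∈ homogComp (R := R) 𝒲.comp g ∧ ∀ f' : Module.End R W, f * f' = f' * f})
    -- ε : the primitive idempotents of the center 𝒵 of D
    (m : ℕ) (ε : Fin m → Module.End R W)
    (hεcentral : ∀ (i : Fin m) (f : Module.End R W), ε i * f = f * ε i)
    (hεidem : ∀ i, ε i * ε i = ε i)
    (hεorth : ∀ i j, i ≠ j → ε i * ε j = 0)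
    (hεsum : ∑ i, ε i = 1)
    (hεprim : ∀ i, ε i ≠ 0 ∧ ∀ e : Module.End R W, (∀ f, e * f = f * e) →
      e * e = e → e * ε i = e → e = 0 ∨ e = ε i) :
    (∀ i : Fin m,
      -- Dε_i is a G/Z-graded division algebra with unit ε_i ...
      (ε i ∈ cornerGrading Z 𝒲.comp (ε i) 0) ∧
      (∀ q : G ⧸ Z, ∀ x ∈ cornerGrading Z 𝒲.comp (ε i) q, x ≠ 0 →
        ∃ y ∈ cornerGrading Z 𝒲.comp (ε i) (-q), x * y = ε i ∧ y * x = ε i) ∧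
      -- ... whose components decompose the corner Dε_i ...
      (∀ q : G ⧸ Z, cornerGrading Z 𝒲.comp (ε i) q ≤ cornerSubmodule (ε i)) ∧
      (∀ x ∈ cornerSubmodule (F := F) (ε i),
        ∃ (t : Finset (G ⧸ Z)) (cc : (G ⧸ Z) → Module.End R W),
          (∀ q ∈ t, cc q ∈ cornerGrading Z 𝒲.comp (ε i) q) ∧ x = ∑ q ∈ t, cc q) ∧
      (∀ (t : Finset (G ⧸ Z)) (cc : (G ⧸ Z) → Module.End R W),
        (∀ q ∈ t, cc q ∈ cornerGrading Z 𝒲.comp (ε i) q) → ∑ q ∈ t, cc q = 0 →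
        ∀ q ∈ t, cc q = 0) ∧
      -- ... with support T/Z ...
      ({q : G ⧸ Z | cornerGrading Z 𝒲.comp (ε i) q ≠ ⊥}
        = ⇑(QuotientAddGroup.mk' Z) '' T) ∧
      -- ... and central
      (∀ x ∈ cornerSubmodule (F := F) (ε i),
        (∀ y ∈ cornerSubmodule (F := F) (ε i), x * y = y * x) →
        ∃ a : F, x = a • ε i)) ∧
    -- n_1 = ⋯ = n_m = |H/Z| = √|T/Z|
    (∀ i : Fin m,
      Module.finrank F ↥(cornerSubmodule (F := F) (ε i))
        = Nat.card ↥(⇑(QuotientAddGroup.mk' Z) '' T) ∧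
      Module.finrank F ↥(cornerSubmodule (F := F) (ε i))
        = (Nat.card ↥(⇑(QuotientAddGroup.mk' Z) '' ((H : Set G)))) ^ 2) ∧
    -- the Dε_i are pairwise isomorphic as G/Z-graded algebras
    (∀ i j : Fin m, ∃ e : Module.End R W →ₗ[F] Module.End R W,
      Set.BijOn ⇑e ↑(cornerSubmodule (F := F) (ε i)) ↑(cornerSubmodule (F := F) (ε j)) ∧
      e (ε i) = ε j ∧
      (∀ x ∈ cornerSubmodule (F := F) (ε i), ∀ y ∈ cornerSubmodule (F := F) (ε i),
        e (x * y) = e x * e y) ∧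
      (∀ q : G ⧸ Z, ∀ x ∈ cornerGrading Z 𝒲.comp (ε i) q,
        e x ∈ cornerGrading Z 𝒲.comp (ε j) q)) := by
  have hnt : Nontrivial (Module.End R W) := by
    obtain ⟨v, hv⟩ := hsimple.1
    refine ⟨⟨1, 0, fun h => hv ?_⟩⟩
    have := LinearMap.congr_fun h v
    simpa using this
  have hG := homogComp_gda 𝒜 𝒲 hsimple
  have S : Setup (homogComp (R := R) 𝒲.comp) H c :=
    { gda := hG
      fin := hHfin.to_subtype
      card := fun h => hchar ((ringChar.spec F _).1 h)
      c0 := hc0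
      chom := hchom
      cmul := hcmul
      centr := centr_of_max hG hchom hcmul hmax }
  have hZc : CenterSupp (homogComp (R := R) 𝒲.comp) Z := hZ
  have hTs : T = (S.gda.supp : Set G) := hT
  have E : ∀ i, PrimIdem (ε i) := fun i =>
    ⟨hεcentral i, hεidem i, (hεprim i).1, (hεprim i).2⟩
  rw [hTs]
  refine ⟨fun i => ⟨?_, S.cG_inv hZc (E i), S.cG_le hZc (E i), S.cG_span (E i),
    S.cG_indep hZc (E i), S.cG_supp hZc (E i), S.corner_central hZc (E i)⟩,
    fun i => ⟨S.finrank_corner hZc (E i), ?_⟩, fun i j => S.iso hZc (E i) (E j)⟩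
  · have := mul_mem_cG (Z := Z) (ε i) S.gda.one_mem
    rw [one_mul, map_zero] at this
    exact this
  · rw [S.finrank_corner hZc (E i), S.card_image, S.card_image, S.relIndex_sq hZc]

end GradedPaper
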